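/- arXiv:2211.13741 — 6 statements merged into one kernel-verified Lean document; each statement's English description precedes it below -/
import Mathlib

section
/- There exists a constant ε > 0 such that for every n ≥ 1 and every strategy f, g, h : {0,1}^n → {0,1}^n for the n-fold repeated GHZ game, the number of question triples (x,y,z) ∈ S^n on which the strategy wins is at most 2^{-εn} · 4^n. Equivalently, val(GHZ^⊗n) ≤ 2^{-εn}. -/
/-- A question triple `(x,y,z)` of the `n`-fold GHZ game: `x_i ⊕ y_i ⊕ z_i = 0` for all `i`. -/
def GHZQuestion {n : ℕ} (p : (Fin n → Bool) × (Fin n → Bool) × (Fin n → Bool)) : Prop :=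
  ∀ i, Bool.xor (p.1 i) (Bool.xor (p.2.1 i) (p.2.2 i)) = false

/-- The strategy `(f,g,h)` wins on the question triple `p = (x,y,z)`:
`f(x)_i ⊕ g(y)_i ⊕ h(z)_i = x_i ∨ y_i ∨ z_i` for all `i`. -/
def GHZWins {n : ℕ} (f g h : (Fin n → Bool) → (Fin n → Bool))
    (p : (Fin n → Bool) × (Fin n → Bool) × (Fin n → Bool)) : Prop :=
  ∀ i, Bool.xor (f p.1 i) (Bool.xor (g p.2.1 i) (h p.2.2 i)) = (p.1 i || p.2.1 i || p.2.2 i)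


section GHZAux
open Finset

/-- Pairs of elements of `A` with difference `d`. -/
def ghzDiff {G : Type*} [AddCommGroup G] [DecidableEq G] (A : Finset G) (d : G) : Finset (G × G) :=
  (A ×ˢ A).filter fun x => x.1 - x.2 = d

/-- Pairs of elements of `A` with sum `s`. -/
def ghzSum {G : Type*} [AddCommGroup G] [DecidableEq G] (A : Finset G) (s : G) : Finset (G × G) :=
  (A ×ˢ A).filter fun x => x.1 + x.2 = s

/-- Additive quadruples. -/
def ghzQuad {G : Type*} [AddCommGroup G] [DecidableEq G] (A : Finset G) :
    Finset ((G × G) × (G × G)) :=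
  ((A ×ˢ A) ×ˢ (A ×ˢ A)).filter fun x => x.1.1 + x.1.2 = x.2.1 + x.2.2

lemma ghz_energy_eq_sum {G : Type*} [AddCommGroup G] [DecidableEq G] [Fintype G]
    (A B : Finset G) :
    A.addEnergy B = ∑ d : G, (ghzDiff A d).card * (ghzDiff B (-d)).card := by
  unfold Finset.addEnergy
  rw [card_eq_sum_card_fiberwise (f := fun x => x.1.1 - x.1.2) (t := univ)
    (fun _ _ => by simp)]
  refine sum_congr rfl fun d _ => ?_
  rw [← card_product]
  congr 1
  ext ⟨⟨a, a'⟩, b, b'⟩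
  simp only [ghzDiff, mem_filter, mem_product]
  constructor
  · rintro ⟨⟨⟨h1, h2⟩, h3⟩, rfl⟩
    refine ⟨⟨h1, rfl⟩, h2, ?_⟩
    rw [neg_sub, sub_eq_sub_iff_add_eq_add, add_comm, h3, add_comm]
  · rintro ⟨⟨h1, rfl⟩, h2, h3⟩
    refine ⟨⟨⟨h1, h2⟩, ?_⟩, rfl⟩
    have : b = (b - b') + b' := by abel
    rw [this, h3]; abel

lemma ghz_card_diff_neg {G : Type*} [AddCommGroup G] [DecidableEq G]
    (A : Finset G) (d : G) : (ghzDiff A (-d)).card = (ghzDiff A d).card := by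
  refine card_equiv (Equiv.prodComm _ _) ?_
  rintro ⟨a, b⟩
  simp only [ghzDiff, mem_filter, mem_product, Equiv.prodComm_apply, Prod.swap]
  rw [← neg_sub b a, neg_inj]
  tauto

lemma ghz_energy_self {G : Type*} [AddCommGroup G] [DecidableEq G] [Fintype G]
    (A : Finset G) : A.addEnergy A = ∑ d : G, (ghzDiff A d).card ^ 2 := by
  rw [ghz_energy_eq_sum]
  simp_rw [ghz_card_diff_neg, sq]

lemma ghz_energy_le {G : Type*} [AddCommGroup G] [DecidableEq G] [Fintype G]
    (A : Finset G) : A.addEnergy A ≤ A.card ^ 3 := by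
  have : A.addEnergy A ≤ ((A ×ˢ A) ×ˢ A).card := by
    unfold Finset.addEnergy
    refine card_le_card_of_injOn (fun x => (x.1, x.2.1)) ?_ ?_
    · intro x hx
      simp only [coe_filter, mem_product, Set.mem_ofPred_eq] at hx
      simp only [coe_product, Set.mem_prod, mem_coe]
      tauto
    · rintro ⟨⟨a, b⟩, c, d⟩ hx ⟨⟨a', b'⟩, c', d'⟩ hy h
      simp only [coe_filter, mem_product, Set.mem_ofPred_eq] at hx hy
      simp only [Prod.mk.injEq] at h ⊢
      obtain ⟨⟨rfl, rfl⟩, rfl⟩ := h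
      refine ⟨⟨rfl, rfl⟩, rfl, ?_⟩
      exact add_left_cancel (hx.2.symm.trans hy.2)
  simpa [card_product, pow_succ] using this

lemma ghz_energy_sq_le {G : Type*} [AddCommGroup G] [DecidableEq G] [Fintype G]
    (A B : Finset G) : A.addEnergy B ^ 2 ≤ A.addEnergy A * B.addEnergy B := by
  rw [ghz_energy_self A, ghz_energy_self B, ghz_energy_eq_sum A B]
  simp_rw [ghz_card_diff_neg]
  exact sum_mul_sq_le_sq_mul_sq _ _ _

lemma ghz_triples {G : Type*} [AddCommGroup G] [DecidableEq G] [Fintype G]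
    (A B C : Finset G) (N T : ℕ) (hA : A.card = N) (hB : B.card = N) (hC : C.card = N)
    (hT : T ≤ #{xy ∈ A ×ˢ B | xy.1 + xy.2 ∈ C}) :
    T ^ 4 ≤ N ^ 5 * A.addEnergy A := by
  have h1 : T ^ 2 ≤ N * A.addEnergy B := by
    calc T ^ 2 ≤ _ := Nat.pow_le_pow_left hT 2
      _ ≤ _ := card_sq_le_card_mul_addEnergy A B C
      _ = _ := by rw [hC]
  calc T ^ 4 = (T ^ 2) ^ 2 := by ring
    _ ≤ (N * A.addEnergy B) ^ 2 := Nat.pow_le_pow_left h1 2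
    _ = N ^ 2 * A.addEnergy B ^ 2 := by ring
    _ ≤ N ^ 2 * (A.addEnergy A * B.addEnergy B) :=
        Nat.mul_le_mul_left _ (ghz_energy_sq_le A B)
    _ ≤ N ^ 2 * (A.addEnergy A * N ^ 3) := by
        have := ghz_energy_le B
        rw [hB] at this
        gcongr
    _ = _ := by ring

lemma ghz_quad_card {G : Type*} [AddCommGroup G] [DecidableEq G]
    (A : Finset G) : (ghzQuad A).card = A.addEnergy A :=
  (Finset.addEnergy_eq_card_filter A A).symm

lemma ghz_upper {G : Type*} [AddCommGroup G] [DecidableEq G]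
    (A : Finset G)
    (hinj : ∀ p ∈ A, ∀ a ∈ A, ∀ p' ∈ A, ∀ a' ∈ A, p + p - a = p' + p' - a' → p = p' ∧ a = a') :
    ∑ q ∈ ghzQuad A, (ghzSum A (q.1.1 + q.1.2)).card *
      ((ghzDiff A (q.1.1 - q.2.1)).card * (ghzDiff A (q.1.1 - q.2.2)).card) ≤ A.card ^ 5 := by
  have h5 : A.card ^ 5 = (A ×ˢ (A ×ˢ A) ×ˢ (A ×ˢ A)).card := by
    simp only [card_product]; ring
  rw [h5]
  simp_rw [← card_product]
  rw [← card_sigma]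
  refine card_le_card_of_injOn (fun x => (x.2.1.2, x.2.2.1, x.2.2.2)) ?_ ?_
  · rintro ⟨⟨⟨p, y⟩, u, v⟩, ⟨a, x⟩, ⟨u1, u2⟩, u3, u4⟩ hx
    simp only [ghzQuad, ghzSum, ghzDiff, coe_sigma, Set.mem_sigma_iff, mem_coe, mem_filter,
      mem_product] at hx ⊢
    tauto
  · rintro ⟨⟨⟨p, y⟩, u, v⟩, ⟨a, x⟩, ⟨u1, u2⟩, u3, u4⟩ hx
      ⟨⟨⟨p', y'⟩, u', v'⟩, ⟨a', x'⟩, ⟨u1', u2'⟩, u3', u4'⟩ hx' h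
    simp only [ghzQuad, ghzSum, ghzDiff, coe_sigma, Set.mem_sigma_iff, mem_coe, mem_filter,
      mem_product] at hx hx'
    simp only [Prod.mk.injEq] at h
    obtain ⟨rfl, ⟨rfl, rfl⟩, rfl, rfl⟩ := h
    obtain ⟨⟨⟨⟨hp, hy⟩, hu, hv⟩, e1⟩, ⟨⟨ha, hx⟩, e2⟩, ⟨-, e3⟩, -, e4⟩ := hx
    obtain ⟨⟨⟨⟨hp', hy'⟩, hu', hv'⟩, e1'⟩, ⟨⟨ha', -⟩, e2'⟩, ⟨-, e3'⟩, -, e4'⟩ := hx'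
    have k1 : p + p - a = x + (u1 - u2) + (u3 - u4) := by
      have ea : a = u + v - x := by rw [← e1, ← e2]; abel
      rw [e3, e4, ea]; abel
    have k2 : p' + p' - a' = x + (u1 - u2) + (u3 - u4) := by
      have ea : a' = u' + v' - x := by rw [← e1', ← e2']; abel
      rw [e3', e4', ea]; abel
    obtain ⟨rfl, rfl⟩ := hinj p hp a ha p' hp' a' ha' (k1.trans k2.symm)
    have : u = u' := sub_right_injective (e3.symm.trans e3')
    subst this
    have : v = v' := sub_right_injective (e4.symm.trans e4')
    subst this
    have : y = y' := add_left_cancel (e1.trans e1'.symm)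
    subst this
    rfl

/-- Few quadruples have unpopular fibres. -/
lemma ghz_bad {α β : Type*} [DecidableEq β] (Q : Finset α) (P : Finset β) (φ : α → β)
    (hφ : ∀ q ∈ Q, φ q ∈ P) (w : β → ℕ)
    (hw : ∀ b ∈ P, #{q ∈ Q | φ q = b} ≤ w b) (τ : ℝ) (hτ : 0 ≤ τ) :
    ((#{q ∈ Q | (w (φ q) : ℝ) < τ} : ℕ) : ℝ) ≤ P.card * τ := by
  rw [card_eq_sum_card_fiberwise (f := φ) (t := P)
    (fun q hq => hφ q (mem_filter.1 hq).1)]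
  push_cast
  rw [← nsmul_eq_mul]
  refine sum_le_card_nsmul _ _ _ fun b hb => ?_
  by_cases hb' : (w b : ℝ) < τ
  · refine le_trans ?_ hb'.le
    refine le_trans ?_ (Nat.cast_le.2 (hw b hb))
    refine Nat.cast_le.2 (card_le_card ?_)
    intro q hq
    simp only [mem_filter] at hq ⊢
    tauto
  · rw [card_eq_zero.2]
    · simpa using hτ
    · rw [filter_eq_empty_iff]
      rintro q hq rfl
      exact hb' (mem_filter.1 hq).2

lemma ghz_popular {α : Type*} (Q : Finset α) (w1 w2 w3 : α → ℕ) (E τ : ℝ) (hτ : 0 ≤ τ)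
    (hQ : (Q.card : ℝ) = E)
    (b1 : ((#{q ∈ Q | (w1 q : ℝ) < τ} : ℕ) : ℝ) ≤ E / 4)
    (b2 : ((#{q ∈ Q | (w2 q : ℝ) < τ} : ℕ) : ℝ) ≤ E / 4)
    (b3 : ((#{q ∈ Q | (w3 q : ℝ) < τ} : ℕ) : ℝ) ≤ E / 4) :
    E / 4 * (τ * (τ * τ)) ≤ ((∑ q ∈ Q, w1 q * (w2 q * w3 q) : ℕ) : ℝ) := by
  classical
  set B1 := Q.filter fun q => (w1 q : ℝ) < τ with hB1
  set B2 := Q.filter fun q => (w2 q : ℝ) < τ with hB2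
  set B3 := Q.filter fun q => (w3 q : ℝ) < τ with hB3
  obtain ⟨Q', hQ'⟩ : ∃ Q', Q' = Q \ (B1 ∪ B2 ∪ B3) := ⟨_, rfl⟩
  have hQ'card : E / 4 ≤ Q'.card := by
    have h1 : Q.card ≤ Q'.card + (B1.card + B2.card + B3.card) := by
      have h2 := le_card_sdiff (B1 ∪ B2 ∪ B3) Q
      rw [← hQ'] at h2
      have h3 := card_union_le (B1 ∪ B2) B3
      have h4 := card_union_le B1 B2
      omega
    have h2 : (Q.card : ℝ) ≤ Q'.card + (B1.card + B2.card + B3.card) := by exact_mod_cast h1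
    linarith
  push_cast
  calc E / 4 * (τ * (τ * τ)) ≤ Q'.card * (τ * (τ * τ)) := by gcongr
    _ = Q'.card • (τ * (τ * τ)) := by rw [nsmul_eq_mul]
    _ ≤ ∑ q ∈ Q', (w1 q : ℝ) * (w2 q * w3 q) := by
        refine card_nsmul_le_sum _ _ _ fun q hq => ?_
        simp only [hQ', hB1, hB2, hB3, mem_sdiff, mem_union, mem_filter, not_or, not_and,
          not_lt] at hq
        obtain ⟨hq0, ⟨h1, h2⟩, h3⟩ := hq
        have h1 := h1 hq0
        have h2 := h2 hq0
        have h3 := h3 hq0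
        gcongr
    _ ≤ _ := by
        refine sum_le_sum_of_subset_of_nonneg (by rw [hQ']; exact sdiff_subset)
          fun _ _ _ => by positivity

lemma ghz_energy_bound {G : Type*} [AddCommGroup G] [DecidableEq G]
    (A : Finset G) (hne : A.Nonempty)
    (hinj : ∀ p ∈ A, ∀ a ∈ A, ∀ p' ∈ A, ∀ a' ∈ A, p + p - a = p' + p' - a' → p = p' ∧ a = a') :
    A.addEnergy A ^ 4 ≤ 256 * A.card ^ 11 := by
  have hN : (0 : ℝ) < A.card := by exact_mod_cast hne.card_pos
  set N : ℝ := (A.card : ℝ) with hNdef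
  set E : ℝ := (A.addEnergy A : ℝ) with hE
  set τ : ℝ := E / (4 * N ^ 2) with hτdef
  have hE0 : 0 ≤ E := Nat.cast_nonneg _
  have hτ : 0 ≤ τ := by positivity
  have hPτ : (((A ×ˢ A).card : ℕ) : ℝ) * τ = E / 4 := by
    rw [card_product]; push_cast; rw [← hNdef, hτdef]; field_simp
  have b1 := ghz_bad (ghzQuad A) (A ×ˢ A) (fun q => q.1)
    (by intro q hq; simp only [ghzQuad, mem_filter, mem_product] at hq ⊢; tauto)
    (fun b => (ghzSum A (b.1 + b.2)).card) (by
      rintro ⟨p, y⟩ hb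
      refine card_le_card_of_injOn (fun q => q.2) ?_ ?_
      · rintro ⟨⟨p', y'⟩, u, v⟩ hq
        simp only [ghzQuad, ghzSum, coe_filter, mem_filter, mem_product, Set.mem_ofPred_eq,
          Prod.mk.injEq] at hq ⊢
        obtain ⟨⟨h1, h2⟩, rfl, rfl⟩ := hq
        exact ⟨h1.2, h2.symm⟩
      · rintro ⟨⟨p', y'⟩, u, v⟩ hq ⟨⟨p'', y''⟩, u', v'⟩ hq' h
        simp only [coe_filter, Set.mem_ofPred_eq] at hq hq' h
        rw [Prod.mk.injEq]
        exact ⟨hq.2.trans hq'.2.symm, h⟩) τ hτ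
  have b2 := ghz_bad (ghzQuad A) (A ×ˢ A) (fun q => (q.1.1, q.2.1))
    (by intro q hq; simp only [ghzQuad, mem_filter, mem_product] at hq ⊢; tauto)
    (fun b => (ghzDiff A (b.1 - b.2)).card) (by
      rintro ⟨p, u⟩ hb
      refine card_le_card_of_injOn (fun q => (q.2.2, q.1.2)) ?_ ?_
      · rintro ⟨⟨p', y'⟩, u', v⟩ hq
        simp only [ghzQuad, ghzDiff, coe_filter, mem_filter, mem_product, Set.mem_ofPred_eq,
          Prod.mk.injEq] at hq ⊢
        obtain ⟨⟨h1, h2⟩, rfl, rfl⟩ := hq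
        refine ⟨⟨h1.2.2, h1.1.2⟩, ?_⟩
        rw [sub_eq_sub_iff_add_eq_add, h2, add_comm]
      · rintro ⟨⟨p', y'⟩, u, v⟩ hq ⟨⟨p'', y''⟩, u', v'⟩ hq' h
        simp only [coe_filter, Set.mem_ofPred_eq, Prod.mk.injEq] at hq hq' h ⊢
        obtain ⟨-, rfl, rfl⟩ := hq
        obtain ⟨-, rfl, rfl⟩ := hq'
        tauto) τ hτ
  have b3 := ghz_bad (ghzQuad A) (A ×ˢ A) (fun q => (q.1.1, q.2.2))
    (by intro q hq; simp only [ghzQuad, mem_filter, mem_product] at hq ⊢; tauto)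
    (fun b => (ghzDiff A (b.1 - b.2)).card) (by
      rintro ⟨p, u⟩ hb
      refine card_le_card_of_injOn (fun q => (q.2.1, q.1.2)) ?_ ?_
      · rintro ⟨⟨p', y'⟩, u', v⟩ hq
        simp only [ghzQuad, ghzDiff, coe_filter, mem_filter, mem_product, Set.mem_ofPred_eq,
          Prod.mk.injEq] at hq ⊢
        obtain ⟨⟨h1, h2⟩, rfl, rfl⟩ := hq
        refine ⟨⟨h1.2.1, h1.1.2⟩, ?_⟩
        rw [sub_eq_sub_iff_add_eq_add, h2]
      · rintro ⟨⟨p', y'⟩, u, v⟩ hq ⟨⟨p'', y''⟩, u', v'⟩ hq' h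
        simp only [coe_filter, Set.mem_ofPred_eq, Prod.mk.injEq] at hq hq' h ⊢
        obtain ⟨-, rfl, rfl⟩ := hq
        obtain ⟨-, rfl, rfl⟩ := hq'
        tauto) τ hτ
  rw [hPτ] at b1 b2 b3
  have hup := ghz_upper A hinj
  have hlow := ghz_popular (ghzQuad A) (fun q => (ghzSum A (q.1.1 + q.1.2)).card)
    (fun q => (ghzDiff A (q.1.1 - q.2.1)).card) (fun q => (ghzDiff A (q.1.1 - q.2.2)).card)
    E τ hτ (by rw [ghz_quad_card]) b1 b2 b3
  have hfin : E / 4 * (τ * (τ * τ)) ≤ N ^ 5 := by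
    refine hlow.trans ?_
    rw [hNdef]
    exact_mod_cast hup
  have : E ^ 4 ≤ 256 * N ^ 11 := by
    have h : E / 4 * (τ * (τ * τ)) = E ^ 4 / (256 * N ^ 6) := by
      rw [hτdef]; field_simp; norm_num
    rw [h, div_le_iff₀ (by positivity)] at hfin
    calc E ^ 4 ≤ _ := hfin
      _ = _ := by ring
  rw [hE, hNdef] at this
  exact_mod_cast this

/-- Coordinatewise encoding in `ZMod 4`. -/
def ghzBit (b c : Bool) : ZMod 4 := (if b then 1 else 0) + (if c then 2 else 0)

/-- The encoding of a strategy in `(ZMod 4)^n`. -/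
def ghzEnc {n : ℕ} (f : (Fin n → Bool) → (Fin n → Bool)) (x : Fin n → Bool) : Fin n → ZMod 4 :=
  fun i => ghzBit (x i) (f x i)

lemma ghz_bit_inj : ∀ b c b' c', ghzBit b c = ghzBit b' c' → b = b' := by decide

lemma ghz_bit_neg_inj : ∀ b c b' c', -ghzBit b c = -ghzBit b' c' → b = b' := by decide

lemma ghz_bit_inj2 : ∀ b c d e b' c' d' e',
    ghzBit b c + ghzBit b c - ghzBit d e = ghzBit b' c' + ghzBit b' c' - ghzBit d' e' →
    d = d' := by decide

lemma ghz_bit_inj3 : ∀ b c b' c',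
    ghzBit b c + ghzBit b c = ghzBit b' c' + ghzBit b' c' → b = b' := by decide

lemma ghz_bit_win : ∀ x y z f g h : Bool, Bool.xor x (Bool.xor y z) = false →
    Bool.xor f (Bool.xor g h) = (x || y || z) →
    ghzBit x f + ghzBit y g = -ghzBit z h := by decide

lemma ghz_enc_inj {n : ℕ} (f : (Fin n → Bool) → (Fin n → Bool)) :
    Function.Injective (ghzEnc f) := fun x y h => funext fun i =>
  ghz_bit_inj _ _ _ _ (congrFun h i)

lemma ghz_count {n : ℕ} (f g h : (Fin n → Bool) → (Fin n → Bool)) :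
    (Nat.card {p : (Fin n → Bool) × (Fin n → Bool) × (Fin n → Bool) //
            GHZQuestion p ∧ GHZWins f g h p}) ^ 16 ≤ 2 ^ (31 * n + 8) := by
  classical
  set T := Nat.card {p : (Fin n → Bool) × (Fin n → Bool) × (Fin n → Bool) //
            GHZQuestion p ∧ GHZWins f g h p} with hTdef
  set A := univ.image (ghzEnc f) with hA
  set B := univ.image (ghzEnc g) with hB
  set C := univ.image (fun z => -ghzEnc h z) with hC
  have hAc : A.card = 2 ^ n := by
    rw [hA, card_image_of_injective _ (ghz_enc_inj f)]; simp
  have hBc : B.card = 2 ^ n := by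
    rw [hB, card_image_of_injective _ (ghz_enc_inj g)]; simp
  have hCc : C.card = 2 ^ n := by
    have hi : Function.Injective (fun z => -ghzEnc h z) := neg_injective.comp (ghz_enc_inj h)
    rw [hC, card_image_of_injective _ hi]; simp
  have hT : T ≤ #{xy ∈ A ×ˢ B | xy.1 + xy.2 ∈ C} := by
    rw [hTdef, Nat.card_eq_fintype_card, Fintype.card_subtype]
    have key : ∀ x y z, GHZQuestion (x, y, z) ∧ GHZWins f g h (x, y, z) →
        ghzEnc f x + ghzEnc g y = -ghzEnc h z := by
      rintro x y z ⟨h1, h2⟩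
      funext i
      exact ghz_bit_win _ _ _ _ _ _ (h1 i) (h2 i)
    refine card_le_card_of_injOn (fun p => (ghzEnc f p.1, ghzEnc g p.2.1)) ?_ ?_
    · rintro ⟨x, y, z⟩ hp
      simp only [coe_filter, mem_univ, true_and, Set.mem_ofPred_eq] at hp
      simp only [coe_filter, mem_product, Set.mem_ofPred_eq]
      exact ⟨⟨mem_image_of_mem _ (mem_univ _), mem_image_of_mem _ (mem_univ _)⟩,
        mem_image.2 ⟨z, mem_univ _, (key x y z hp).symm⟩⟩
    · rintro ⟨x, y, z⟩ hp ⟨x', y', z'⟩ hp' he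
      simp only [coe_filter, mem_univ, true_and, Set.mem_ofPred_eq] at hp hp'
      simp only [Prod.mk.injEq] at he
      obtain rfl := ghz_enc_inj f he.1
      obtain rfl := ghz_enc_inj g he.2
      have := (key _ _ _ hp).symm.trans (key _ _ _ hp')
      obtain rfl := ghz_enc_inj h (neg_injective this)
      rfl
  have h1 := ghz_triples A B C (2 ^ n) T hAc hBc hCc hT
  have h2 := ghz_energy_bound A (card_pos.1 (by rw [hAc]; positivity)) (by
    intro p hp a ha p' hp' a' ha' he
    obtain ⟨x, -, rfl⟩ := mem_image.1 hp
    obtain ⟨y, -, rfl⟩ := mem_image.1 ha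
    obtain ⟨x', -, rfl⟩ := mem_image.1 hp'
    obtain ⟨y', -, rfl⟩ := mem_image.1 ha'
    obtain rfl : y = y' := funext fun i => ghz_bit_inj2 _ _ _ _ _ _ _ _ (congrFun he i)
    have he' := sub_left_injective he
    obtain rfl : x = x' := funext fun i => ghz_bit_inj3 _ _ _ _ (congrFun he' i)
    exact ⟨rfl, rfl⟩)
  rw [hAc] at h2
  calc T ^ 16 = (T ^ 4) ^ 4 := by ring
    _ ≤ ((2 ^ n) ^ 5 * A.addEnergy A) ^ 4 := Nat.pow_le_pow_left h1 4
    _ = (2 ^ n) ^ 20 * A.addEnergy A ^ 4 := by ring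
    _ ≤ (2 ^ n) ^ 20 * (256 * (2 ^ n) ^ 11) := Nat.mul_le_mul_left _ h2
    _ = (2 ^ n) ^ 31 * 2 ^ 8 := by ring
    _ = _ := by rw [pow_add, ← pow_mul, mul_comm n]

/-- No perfect strategy. -/
lemma ghz_not_perfect {n : ℕ} (hn : 1 ≤ n) (f g h : (Fin n → Bool) → (Fin n → Bool)) :
    Nat.card {p : (Fin n → Bool) × (Fin n → Bool) × (Fin n → Bool) //
            GHZQuestion p ∧ GHZWins f g h p} + 1 ≤ 4 ^ n := by
  classical
  rw [Nat.card_eq_fintype_card, Fintype.card_subtype]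
  have hS : #{p : (Fin n → Bool) × (Fin n → Bool) × (Fin n → Bool) | GHZQuestion p} ≤ 4 ^ n := by
    have : (4 : ℕ) ^ n = (univ : Finset ((Fin n → Bool) × (Fin n → Bool))).card := by
      rw [show (4 : ℕ) = 2 * 2 by norm_num, mul_pow]
      simp
    rw [this]
    refine card_le_card_of_injOn (fun p => (p.1, p.2.1)) (by simp) ?_
    rintro ⟨x, y, z⟩ hp ⟨x', y', z'⟩ hp' he
    simp only [coe_filter, mem_univ, true_and, Set.mem_ofPred_eq] at hp hp'
    simp only [Prod.mk.injEq] at he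
    obtain ⟨rfl, rfl⟩ := he
    have : z = z' := funext fun i => by
      have h1 := hp i
      have h2 := hp' i
      simp only at h1 h2
      revert h1 h2
      generalize x i = a
      generalize y i = b
      generalize z i = c
      generalize z' i = d
      revert a b c d
      decide
    subst this
    rfl
  refine le_trans (Nat.succ_le_of_lt (card_lt_card ?_)) hS
  rw [ssubset_iff_subset_ne]
  refine ⟨fun p hp => by simp only [mem_filter, mem_univ, true_and] at hp ⊢; exact hp.1, ?_⟩
  intro heq
  have hall : ∀ p : (Fin n → Bool) × (Fin n → Bool) × (Fin n → Bool),
      GHZQuestion p → GHZWins f g h p := by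
    intro p hp
    have : p ∈ (univ.filter fun p : (Fin n → Bool) × (Fin n → Bool) × (Fin n → Bool) =>
        GHZQuestion p) := by simpa using hp
    rw [← heq] at this
    exact (mem_filter.1 this).2.2
  let o : Fin n → Bool := fun _ => false
  let e : Fin n → Bool := fun _ => true
  let i : Fin n := ⟨0, hn⟩
  have w1 := hall (o, o, o) (fun _ => rfl) i
  have w2 := hall (o, e, e) (fun _ => rfl) i
  have w3 := hall (e, o, e) (fun _ => rfl) i
  have w4 := hall (e, e, o) (fun _ => rfl) i
  simp only [o, e] at w1 w2 w3 w4
  revert w1 w2 w3 w4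
  generalize f (fun _ => false) i = a
  generalize f (fun _ => true) i = b
  generalize g (fun _ => false) i = c
  generalize g (fun _ => true) i = d
  generalize h (fun _ => false) i = k
  generalize h (fun _ => true) i = l
  revert a b c d k l
  decide

end GHZAux

/-- There is `ε > 0` such that for all `n ≥ 1` and all strategies, the number of question
triples in `S^n` on which the strategy wins is at most `2^(-εn) · 4^n`,
i.e. `val(GHZ^⊗n) ≤ 2^(-εn)`. -/
theorem ghz_parallel_repetition_exponential :
    ∃ ε : ℝ, 0 < ε ∧ ∀ n : ℕ, 1 ≤ n →
      ∀ f g h : (Fin n → Bool) → (Fin n → Bool),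
        (Nat.card {p : (Fin n → Bool) × (Fin n → Bool) × (Fin n → Bool) //
            GHZQuestion p ∧ GHZWins f g h p} : ℝ) ≤
          (2 : ℝ) ^ (-(ε * n)) * 4 ^ n := by
  refine ⟨1 / (16 * 4 ^ 16), by positivity, ?_⟩
  intro n hn f g h
  have hc := ghz_count f g h
  have hp := ghz_not_perfect hn f g h
  set T := Nat.card {p : (Fin n → Bool) × (Fin n → Bool) × (Fin n → Bool) //
            GHZQuestion p ∧ GHZWins f g h p} with hT
  have hn0 : (0 : ℝ) ≤ n := Nat.cast_nonneg n
  rcases le_or_gt n 15 with hs | hl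
  · -- small `n`
    have hp' : (T : ℝ) + 1 ≤ 4 ^ n := by exact_mod_cast hp
    have h1 : 1 - (1 / (16 * 4 ^ 16) * n : ℝ) ≤ (2 : ℝ) ^ (-(1 / (16 * 4 ^ 16) * n : ℝ)) := by
      set t : ℝ := 1 / (16 * 4 ^ 16) * n with ht
      have ht0 : 0 ≤ t := by positivity
      rw [Real.rpow_def_of_pos (by norm_num)]
      have := Real.add_one_le_exp (Real.log 2 * -t)
      have hlog : Real.log 2 ≤ 1 := by linarith [Real.log_two_lt_d9]
      nlinarith
    have h2 : (1 / (16 * 4 ^ 16) * n : ℝ) * 4 ^ n ≤ 1 := by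
      have hn16 : (n : ℝ) ≤ 16 := by exact_mod_cast (by omega : n ≤ 16)
      have h4 : (4 : ℝ) ^ n ≤ 4 ^ 16 := pow_le_pow_right₀ (by norm_num) (by omega)
      calc (1 / (16 * 4 ^ 16) * n : ℝ) * 4 ^ n ≤ (1 / (16 * 4 ^ 16) * 16 : ℝ) * 4 ^ 16 := by
            gcongr
        _ = 1 := by norm_num
    have h3 : (0 : ℝ) < 4 ^ n := by positivity
    nlinarith
  · -- large `n`
    have hc' : (T : ℝ) ^ 16 ≤ 2 ^ (31 * n + 8) := by exact_mod_cast hc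
    refine le_of_pow_le_pow_left₀ (n := 16) (by norm_num) (by positivity) (hc'.trans ?_)
    have h4 : (4 : ℝ) ^ n = (2 : ℝ) ^ (2 * n : ℝ) := by
      rw [Real.rpow_mul (by norm_num), Real.rpow_natCast]; norm_num
    rw [h4, ← Real.rpow_add (by norm_num), ← Real.rpow_natCast, ← Real.rpow_natCast,
      ← Real.rpow_mul (by norm_num)]
    refine Real.rpow_le_rpow_of_exponent_le (by norm_num) ?_
    have hn16 : (16 : ℝ) ≤ n := by exact_mod_cast hl
    push_cast
    norm_num
    linarith
end

section
/- There is a constant C > 0 such that for every n ≥ 1 and every strategy f, g, h : {0,1}^n → {0,1}^n for the n-fold repeated GHZ game whose success probability is η, one has η^{1028} ≤ C · 2^{-n}. -/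
open Finset Pointwise in
/-- Dependent random choice: a vertex whose neighbourhood is large with few bad pairs. -/
lemma ghz_drc {X : Type*} [Fintype X] [DecidableEq X] (W : X → X → Prop) [DecidableRel W]
    (η : ℝ) (hX : 0 < Fintype.card X)
    (hE : ∑ y : X, ((#{x | W x y} : ℕ) : ℝ) = η * (Fintype.card X : ℝ) ^ 2) :
    ∃ y : X, η ^ 2 * (Fintype.card X : ℝ) ^ 2 / 2 +
      8 * ∑ x with W x y, ((#{x' | W x' y ∧
        ((#{z | W x z ∧ W x' z} : ℕ) : ℝ) < η ^ 2 / 16 * Fintype.card X} : ℕ) : ℝ)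
      ≤ ((#{x | W x y} : ℕ) : ℝ) ^ 2 := by
  set N : ℝ := ((Fintype.card X : ℕ) : ℝ) with hN
  have hN0 : 0 < N := by rw [hN]; exact_mod_cast hX
  set B : X → X → Prop := fun x x' => ((#{z | W x z ∧ W x' z} : ℕ) : ℝ) < η ^ 2 / 16 * N with hB
  have h1 : (η * N ^ 2) ^ 2 ≤ N * ∑ y : X, ((#{x | W x y} : ℕ) : ℝ) ^ 2 := by
    rw [← hE]
    have := sq_sum_le_card_mul_sum_sq (s := (univ : Finset X)) (f := fun y => ((#{x | W x y} : ℕ) : ℝ))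
    simpa [hN] using this
  have h1' : η ^ 2 * N ^ 3 ≤ ∑ y : X, ((#{x | W x y} : ℕ) : ℝ) ^ 2 := by
    have : N * (η ^ 2 * N ^ 3) ≤ N * ∑ y : X, ((#{x | W x y} : ℕ) : ℝ) ^ 2 := by
      calc _ = (η * N ^ 2) ^ 2 := by ring
        _ ≤ _ := h1
    exact le_of_mul_le_mul_left this hN0
  have h2 : ∑ y : X, ∑ x with W x y, ((#{x' | W x' y ∧ B x x'} : ℕ) : ℝ) ≤ η ^ 2 / 16 * N ^ 3 := by
    have e : ∑ y : X, ∑ x with W x y, ((#{x' | W x' y ∧ B x x'} : ℕ) : ℝ)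
        = ∑ x : X, ∑ x' : X, if B x x' then ((#{z | W x z ∧ W x' z} : ℕ) : ℝ) else 0 := by
      simp only [card_filter, sum_filter, Nat.cast_sum]
      rw [sum_comm]
      refine sum_congr rfl fun x _ => ?_
      have : ∀ y : X, (if W x y then ∑ x' : X, (((if W x' y ∧ B x x' then 1 else 0 : ℕ)) : ℝ) else 0)
          = ∑ x' : X, if B x x' then (if W x y ∧ W x' y then (1 : ℝ) else 0) else 0 := by
        intro y
        by_cases h : W x y
        · simp only [h, if_true, true_and]
          refine sum_congr rfl fun x' _ => ?_
          by_cases h' : W x' y <;> by_cases h'' : B x x' <;> simp [h', h'']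
        · simp [h]
      rw [sum_congr rfl fun y _ => this y, sum_comm]
      refine sum_congr rfl fun x' _ => ?_
      by_cases h'' : B x x'
      · simp [h'']
      · simp [h'']
    rw [e]
    calc _ ≤ ∑ x : X, ∑ x' : X, η ^ 2 / 16 * N := by
          refine sum_le_sum fun x _ => sum_le_sum fun x' _ => ?_
          split_ifs with h
          · exact h.le
          · positivity
      _ = _ := by simp [← hN]; ring
  have h3 : ∑ y : X, (η ^ 2 * N ^ 2 / 2 + 8 * ∑ x with W x y, ((#{x' | W x' y ∧ B x x'} : ℕ) : ℝ))
      ≤ ∑ y : X, ((#{x | W x y} : ℕ) : ℝ) ^ 2 := by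
    rw [sum_add_distrib, ← mul_sum]
    simp only [sum_const, card_univ, nsmul_eq_mul, ← hN]
    nlinarith
  have : Nonempty X := Fintype.card_pos_iff.mp hX
  obtain ⟨y, -, hy⟩ := exists_le_of_sum_le univ_nonempty h3
  exact ⟨y, hy⟩

open Finset Pointwise in
lemma ghz_rep {X Z : Type*} [Fintype X] [DecidableEq X] [AddCommGroup Z] [DecidableEq Z]
    (W : X → X → Prop) [DecidableRel W] (F G : X → Z) (S : Finset Z)
    (hW : ∀ x y, W x y → F x + G y ∈ S)
    (hF : Function.Injective F) (hG : Function.Injective G) (A : Finset X) (t : ℕ)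
    (ht : ∀ a ∈ A, ∀ a' ∈ A,
      t ≤ ∑ c : X, #{z | W a z ∧ W c z} * #{z | W a' z ∧ W c z}) :
    #(A.image F - A.image F) * t ≤ #S ^ 4 := by
  set D := A.image F - A.image F
  let Q := S ×ˢ S ×ˢ S ×ˢ S
  let φ : Z × Z × Z × Z → Z := fun q => q.1 - q.2.1 + q.2.2.1 - q.2.2.2
  have hQ : #Q = #S ^ 4 := by simp [Q, card_product]; ring
  have hfib : ∀ d ∈ D, t ≤ #{q ∈ Q | φ q = d} := by
    intro d hd
    obtain ⟨u, hu, v, hv, rfl⟩ := mem_sub.mp hd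
    obtain ⟨a, ha, rfl⟩ := mem_image.mp hu
    obtain ⟨a', ha', rfl⟩ := mem_image.mp hv
    refine (ht a ha a' ha').trans ?_
    have : ∑ c : X, #{z | W a z ∧ W c z} * #{z | W a' z ∧ W c z}
        = #((univ : Finset X).sigma fun c =>
          (({z | W a z ∧ W c z} : Finset X) ×ˢ ({z | W a' z ∧ W c z} : Finset X))) := by
      simp [card_sigma, card_product]
    rw [this]
    refine card_le_card_of_injOn
      (fun p => (F a + G p.2.1, F p.1 + G p.2.1, F p.1 + G p.2.2, F a' + G p.2.2)) ?_ ?_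
    · rintro ⟨c, b, b'⟩ h
      simp only [coe_sigma, Set.mem_sigma_iff, mem_coe, mem_product, mem_filter, mem_univ, true_and] at h
      simp only [coe_filter, Set.mem_ofPred_eq, Q, mem_product, φ]
      refine ⟨⟨hW _ _ h.1.1, hW _ _ h.1.2, hW _ _ h.2.2, hW _ _ h.2.1⟩, by abel⟩
    · rintro ⟨c, b, b'⟩ - ⟨c1, b1, b1'⟩ - h
      simp only [Prod.mk.injEq, add_right_inj, hG.eq_iff] at h
      obtain ⟨rfl, h2, h3, rfl⟩ := h
      simp only [add_left_inj, hF.eq_iff] at h2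
      subst h2
      rfl
  rw [← hQ]
  calc #D * t = ∑ d ∈ D, t := by simp
    _ ≤ ∑ d ∈ D, #{q ∈ Q | φ q = d} := sum_le_sum hfib
    _ = #{q ∈ Q | φ q ∈ D} := by
      rw [card_eq_sum_card_fiberwise (f := φ) (t := D)]
      · refine sum_congr rfl fun d hd => ?_
        congr 1
        ext q; simp only [mem_filter]
        constructor
        · rintro ⟨h1, rfl⟩; exact ⟨⟨h1, hd⟩, rfl⟩
        · rintro ⟨⟨h1, _⟩, h⟩; exact ⟨h1, h⟩
      · intro q hq; simpa using (mem_filter.mp hq).2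
    _ ≤ #Q := card_filter_le _ _

open Finset Pointwise in
lemma ghz_pl {X Z : Type*} [DecidableEq X] [AddCommGroup Z] [DecidableEq Z]
    (F : X → Z) (hinj : ∀ a b a' b', F a + 2 • F b = F a' + 2 • F b' → a = a' ∧ b = b')
    (A : Finset X) : (#A) ^ 4 ≤ #(A.image F - A.image F) ^ 3 := by
  have hF : Function.Injective F := fun a b h => (hinj a a b a (by rw [h])).1
  obtain rfl | hA := A.eq_empty_or_nonempty
  · simp
  set P := A.image F with hP
  have hPA : #P = #A := card_image_of_injective _ hF
  have hPne : P.Nonempty := hA.image F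
  have h1 : #A ^ 2 ≤ #(3 • P) := by
    rw [pow_two, ← card_product]
    refine card_le_card_of_injOn (fun p => F p.1 + 2 • F p.2) ?_ ?_
    · rintro ⟨a, b⟩ h
      simp only [coe_product, Set.mem_prod, mem_coe] at h
      have ha : F a ∈ P := mem_image_of_mem F h.1
      have hb : F b ∈ P := mem_image_of_mem F h.2
      have : (3 • P) = P + (P + P) := by rw [succ_nsmul', two_nsmul]
      rw [mem_coe, this]
      refine add_mem_add ha ?_
      show 2 • F b ∈ P + P
      rw [two_nsmul]; exact add_mem_add hb hb
    · rintro ⟨a, b⟩ - ⟨a', b'⟩ - h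
      obtain ⟨rfl, rfl⟩ := hinj _ _ _ _ h
      rfl
  have h2 := pluennecke_ruzsa_inequality_nsmul_sub hPne P 3
  have h0 : (0 : ℚ≥0) < #P := by exact_mod_cast hPne.card_pos
  have h3 : ((#A : ℚ≥0)) ^ 2 ≤ (#(P - P) / #P : ℚ≥0) ^ 3 * #P := by
    refine le_trans ?_ h2
    exact_mod_cast h1
  have h4 : ((#A : ℚ≥0)) ^ 4 ≤ (#(P - P) : ℚ≥0) ^ 3 := by
    calc ((#A : ℚ≥0)) ^ 4 = (#A : ℚ≥0) ^ 2 * #P ^ 2 := by rw [hPA]; ring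
      _ ≤ (#(P - P) / #P : ℚ≥0) ^ 3 * #P * #P ^ 2 := by gcongr
      _ = _ := by field_simp
  exact_mod_cast h4

lemma ghz_arith (η N u r a D S t : ℝ) (hη : 0 < η) (hN0 : 0 < N) (hD : 0 ≤ D) (hS0 : 0 ≤ S)
    (huN : η * N / 2 ≤ u) (hAu : u / 2 ≤ a) (hr : r = u / 2 * (η ^ 2 / 16 * N) ^ 2)
    (hrt : r ≤ t) (hrep : D * t ≤ S ^ 4) (hS : S ≤ N) (h2 : a ^ 4 ≤ D ^ 3) :
    η ^ 19 * N ≤ 2 ^ 38 := by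
  have h1 : D * r ≤ N ^ 4 := by
    calc D * r ≤ D * t := by gcongr
      _ ≤ S ^ 4 := hrep
      _ ≤ N ^ 4 := by gcongr
  have h3 : η * N / 4 ≤ a := by linarith
  have h4 : D * η ^ 5 ≤ 1024 * N := by
    have : η ^ 5 * N ^ 3 / 1024 ≤ r := by
      calc _ = (η * N / 2) / 2 * (η ^ 2 / 16 * N) ^ 2 := by ring
        _ ≤ r := by rw [hr]; gcongr
    have h5 : D * (η ^ 5 * N ^ 3 / 1024) ≤ N ^ 4 := le_trans (by gcongr) h1
    have h6 : (D * η ^ 5) * N ^ 3 ≤ (1024 * N) * N ^ 3 := by linarith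
    exact le_of_mul_le_mul_right h6 (by positivity)
  have h5 : (η * N / 4) ^ 4 * η ^ 15 ≤ (1024 * N) ^ 3 := by
    calc _ ≤ a ^ 4 * η ^ 15 := by gcongr
      _ ≤ D ^ 3 * η ^ 15 := by gcongr
      _ = (D * η ^ 5) ^ 3 := by ring
      _ ≤ _ := by gcongr
  have h6 : (η ^ 19 * N) * N ^ 3 ≤ 2 ^ 38 * N ^ 3 := by
    have e : (η * N / 4) ^ 4 * η ^ 15 = (η ^ 19 * N) * N ^ 3 / 256 := by ring
    rw [e] at h5
    linarith
  exact le_of_mul_le_mul_right h6 (by positivity)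

set_option maxHeartbeats 1000000 in
open Finset Pointwise in
lemma ghz_core {X Z : Type*} [Fintype X] [DecidableEq X] [AddCommGroup Z] [DecidableEq Z]
    (W : X → X → Prop) [DecidableRel W] (F G : X → Z) (S : Finset Z)
    (hS : #S ≤ Fintype.card X)
    (hW : ∀ x y, W x y → F x + G y ∈ S)
    (hinj : ∀ a b a' b', F a + 2 • F b = F a' + 2 • F b' → a = a' ∧ b = b')
    (hG : Function.Injective G)
    (η : ℝ) (hη : 0 < η) (hX : 0 < Fintype.card X)
    (hE : ∑ y : X, ((#{x | W x y} : ℕ) : ℝ) = η * (Fintype.card X : ℝ) ^ 2) :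
    η ^ 19 * (Fintype.card X : ℝ) ≤ 2 ^ 38 := by
  have hF : Function.Injective F := fun a b h => (hinj a a b a (by rw [h])).1
  obtain ⟨y, hy⟩ := ghz_drc W η hX hE
  set N : ℝ := ((Fintype.card X : ℕ) : ℝ) with hN
  have hN0 : 0 < N := by rw [hN]; exact_mod_cast hX
  set B : X → X → Prop := fun x x' => ((#{z | W x z ∧ W x' z} : ℕ) : ℝ) < η ^ 2 / 16 * N with hB
  set U : Finset X := {x | W x y} with hU
  have hbad : ∀ x, ({x' | W x' y ∧ B x x'} : Finset X) = {x' ∈ U | B x x'} := by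
    intro x; ext x'; simp [hU]
  change η ^ 2 * N ^ 2 / 2 + 8 * ∑ x ∈ U, ((#{x' | W x' y ∧ B x x'} : ℕ) : ℝ) ≤ (#U : ℝ) ^ 2 at hy
  simp only [hbad] at hy
  set u : ℝ := ((#U : ℕ) : ℝ) with hu
  have hu0 : 0 ≤ u := Nat.cast_nonneg _
  have hsum0 : 0 ≤ ∑ x ∈ U, ((#{x' ∈ U | B x x'} : ℕ) : ℝ) := sum_nonneg fun _ _ => Nat.cast_nonneg _
  have huN : η * N / 2 ≤ u := by
    refine (pow_le_pow_iff_left₀ (by positivity) hu0 two_ne_zero).mp ?_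
    nlinarith [mul_pos hη hN0, sq_nonneg (η * N)]
  have hupos : 0 < u := lt_of_lt_of_le (by positivity) huN
  set A : Finset X := {x ∈ U | ((#{x' ∈ U | B x x'} : ℕ) : ℝ) ≤ u / 4} with hA
  have hAu : u / 2 ≤ #A := by
    have h1 : ∑ x ∈ U with ¬ (((#{x' ∈ U | B x x'} : ℕ) : ℝ) ≤ u / 4), u / 4 ≤
        ∑ x ∈ U, ((#{x' ∈ U | B x x'} : ℕ) : ℝ) := by
      calc _ ≤ ∑ x ∈ U with ¬ (((#{x' ∈ U | B x x'} : ℕ) : ℝ) ≤ u / 4),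
            ((#{x' ∈ U | B x x'} : ℕ) : ℝ) :=
            sum_le_sum fun x hx => (not_le.mp (mem_filter.mp hx).2).le
        _ ≤ _ := sum_le_sum_of_subset_of_nonneg (filter_subset _ _) fun _ _ _ => Nat.cast_nonneg _
    rw [sum_const, nsmul_eq_mul] at h1
    have h2 := card_filter_add_card_filter_not (s := U)
      (fun x => ((#{x' ∈ U | B x x'} : ℕ) : ℝ) ≤ u / 4)
    have h3 : (#A : ℝ) + (#{x ∈ U | ¬ (((#{x' ∈ U | B x x'} : ℕ) : ℝ) ≤ u / 4)} : ℕ) = u := by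
      rw [hu]; exact_mod_cast h2
    have h4 : (#{x ∈ U | ¬ (((#{x' ∈ U | B x x'} : ℕ) : ℝ) ≤ u / 4)} : ℝ) = u - #A := by
      linarith
    rw [h4] at h1
    have h5 : (u - #A) * u ≤ (u / 2) * u := by nlinarith [sq_nonneg (η * N)]
    have := le_of_mul_le_mul_right h5 hupos
    linarith
  set r : ℝ := u / 2 * (η ^ 2 / 16 * N) ^ 2 with hr
  have hT : ∀ a ∈ A, ∀ a' ∈ A,
      ⌈r⌉₊ ≤ ∑ c : X, #{z | W a z ∧ W c z} * #{z | W a' z ∧ W c z} := by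
    intro a ha a' ha'
    rw [Nat.ceil_le]
    push_cast
    have ha2 := (mem_filter.mp ha).2
    have ha2' := (mem_filter.mp ha').2
    set V : Finset X := {c ∈ U | ¬ B a c ∧ ¬ B a' c} with hV
    have hVc : u / 2 ≤ #V := by
      have hsub : U ⊆ V ∪ ({x' ∈ U | B a x'} ∪ {x' ∈ U | B a' x'}) := by
        intro c hc
        simp only [hV, mem_union, mem_filter, hc, true_and]
        tauto
      have h1 := (card_le_card hsub).trans (card_union_le _ _)
      have h2 := card_union_le ({x' ∈ U | B a x'}) ({x' ∈ U | B a' x'})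
      have h3 : u ≤ #V + ((#{x' ∈ U | B a x'} : ℕ) + (#{x' ∈ U | B a' x'} : ℕ)) := by
        rw [hu]; exact_mod_cast h1.trans (by omega)
      linarith
    calc r ≤ #V * (η ^ 2 / 16 * N) ^ 2 := by
          rw [hr]; exact mul_le_mul_of_nonneg_right hVc (sq_nonneg _)
      _ = ∑ c ∈ V, (η ^ 2 / 16 * N) ^ 2 := by simp
      _ ≤ ∑ c ∈ V, (#{z | W a z ∧ W c z} : ℝ) * #{z | W a' z ∧ W c z} := by
        refine sum_le_sum fun c hc => ?_
        obtain ⟨h1, h2⟩ := (mem_filter.mp hc).2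
        rw [pow_two]
        have h1 := not_lt.mp h1
        have h2 := not_lt.mp h2
        exact mul_le_mul h1 h2 (by positivity) (Nat.cast_nonneg _)
      _ ≤ _ := sum_le_sum_of_subset_of_nonneg (subset_univ _) fun _ _ _ =>
        mul_nonneg (Nat.cast_nonneg _) (Nat.cast_nonneg _)
  have hrep := ghz_rep W F G S hW hF hG A _ hT
  have hpl := ghz_pl F hinj A
  set D := #(A.image F - A.image F) with hD
  refine ghz_arith η N u r (#A : ℕ) D (#S : ℕ) ⌈r⌉₊ hη hN0 (Nat.cast_nonneg _) (Nat.cast_nonneg _)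
    huN hAu hr (Nat.le_ceil r) ?_ ?_ ?_
  · exact_mod_cast hrep
  · rw [hN]; exact_mod_cast hS
  · exact_mod_cast hpl

/-- The lift of `(x, f x)` to `ℤ/4`. -/
def ghzLift {n : ℕ} (f : (Fin n → Bool) → (Fin n → Bool)) (x : Fin n → Bool) : Fin n → ZMod 4 :=
  fun i => (if x i then 1 else 0) + (if f x i then 2 else 0)

lemma ghzLift_inj2 {n : ℕ} (f : (Fin n → Bool) → (Fin n → Bool)) (a b a' b' : Fin n → Bool)
    (h : ghzLift f a + 2 • ghzLift f b = ghzLift f a' + 2 • ghzLift f b') : a = a' ∧ b = b' := by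
  have key : ∀ p q r s p' q' r' s' : Bool,
      ((if p then 1 else 0) + (if q then 2 else 0) : ZMod 4) +
        2 • ((if r then 1 else 0) + (if s then 2 else 0) : ZMod 4) =
      ((if p' then 1 else 0) + (if q' then 2 else 0) : ZMod 4) +
        2 • ((if r' then 1 else 0) + (if s' then 2 else 0) : ZMod 4) →
      p = p' ∧ (q = q' → r = r') := by decide
  have h1 : a = a' := by
    ext1 i
    exact (key _ _ _ _ _ _ _ _ (congrFun h i)).1
  subst h1
  refine ⟨rfl, ?_⟩
  ext1 i
  exact (key _ _ _ _ _ _ _ _ (congrFun h i)).2 rfl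

lemma ghzLift_inj {n : ℕ} (f : (Fin n → Bool) → (Fin n → Bool)) :
    Function.Injective (ghzLift f) :=
  fun a b h => (ghzLift_inj2 f a a b a (by rw [h])).1

lemma ghzLift_win {n : ℕ} (f g h : (Fin n → Bool) → (Fin n → Bool)) (x y z : Fin n → Bool)
    (hq : GHZQuestion (x, y, z)) (hw : GHZWins f g h (x, y, z)) :
    ghzLift f x + ghzLift g y = - ghzLift h z := by
  have key : ∀ p q r s t v : Bool, Bool.xor p (Bool.xor q r) = false →
      Bool.xor s (Bool.xor t v) = (p || q || r) →
      ((if p then 1 else 0) + (if s then 2 else 0) : ZMod 4) +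
      ((if q then 1 else 0) + (if t then 2 else 0) : ZMod 4) =
      - ((if r then 1 else 0) + (if v then 2 else 0) : ZMod 4) := by decide
  ext1 i
  exact key _ _ _ _ _ _ (hq i) (hw i)

/-- There is a constant `C > 0` such that for every `n ≥ 1` and every strategy whose success
probability is `η` (i.e. the fraction of the `4^n` triples of `S^n` on which it wins),
one has `η^1028 ≤ C · 2^(-n)`. -/
theorem ghz_success_probability_power_bound :
    ∃ C : ℝ, 0 < C ∧ ∀ n : ℕ, 1 ≤ n →
      ∀ f g h : (Fin n → Bool) → (Fin n → Bool),
        ((Nat.card {p : (Fin n → Bool) × (Fin n → Bool) × (Fin n → Bool) //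
            GHZQuestion p ∧ GHZWins f g h p} : ℝ) / 4 ^ n) ^ 1028 ≤ C * (2 : ℝ) ^ (-(n : ℝ)) := by
  classical
  refine ⟨2 ^ 38, by positivity, fun n _ f g h => ?_⟩
  let Q := {p : (Fin n → Bool) × (Fin n → Bool) × (Fin n → Bool) //
            GHZQuestion p ∧ GHZWins f g h p}
  change ((Nat.card Q : ℝ) / 4 ^ n) ^ 1028 ≤ _
  set η : ℝ := (Nat.card Q : ℝ) / 4 ^ n with hη
  let X := Fin n → Bool
  let W : X → X → Prop := fun x y =>
    GHZQuestion (x, y, fun i => Bool.xor (x i) (y i)) ∧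
      GHZWins f g h (x, y, fun i => Bool.xor (x i) (y i))
  have hz : ∀ x y z : X, GHZQuestion (x, y, z) → z = fun i => Bool.xor (x i) (y i) := by
    intro x y z hq
    have key : ∀ p q r : Bool, Bool.xor p (Bool.xor q r) = false → r = Bool.xor p q := by decide
    ext1 i
    exact key _ _ _ (hq i)
  let e : Q ≃ (Σ y : X, {x : X // W x y}) :=
    { toFun := fun p => ⟨p.1.2.1, p.1.1, by
        obtain ⟨⟨x, y, z⟩, h1, h2⟩ := p
        obtain rfl := hz x y z h1
        exact ⟨h1, h2⟩⟩
      invFun := fun s => ⟨(s.2.1, s.1, fun i => Bool.xor (s.2.1 i) (s.1 i)), s.2.2⟩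
      left_inv := by
        rintro ⟨⟨x, y, z⟩, h1, h2⟩
        obtain rfl := hz x y z h1
        rfl
      right_inv := by
        rintro ⟨y, x, h⟩
        rfl }
  have hcard : Nat.card Q = ∑ y : X, (Finset.univ.filter fun x => W x y).card := by
    rw [Nat.card_congr e, Nat.card_eq_fintype_card, Fintype.card_sigma]
    exact Finset.sum_congr rfl fun y _ => Fintype.card_subtype _
  have hX : Fintype.card X = 2 ^ n := by simp [X]
  have h42 : (4 : ℝ) ^ n = ((Fintype.card X : ℕ) : ℝ) ^ 2 := by
    rw [hX]; push_cast; rw [← pow_mul, mul_comm, pow_mul]; norm_num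
  have hE : ∑ y : X, (((Finset.univ.filter fun x => W x y).card : ℕ) : ℝ)
      = η * (Fintype.card X : ℝ) ^ 2 := by
    rw [← h42, hη, div_mul_cancel₀ _ (by positivity), hcard]
    push_cast; rfl
  have hη0 : 0 ≤ η := by positivity
  have hη1 : η ≤ 1 := by
    rw [hη, div_le_one (by positivity), h42, hcard]
    have : ∑ y : X, (Finset.univ.filter fun x => W x y).card ≤ ∑ y : X, Fintype.card X :=
      Finset.sum_le_sum fun y _ => Finset.card_le_univ _
    rw [Finset.sum_const, Finset.card_univ, smul_eq_mul, ← pow_two] at this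
    exact_mod_cast this
  rw [Real.rpow_neg (by norm_num), Real.rpow_natCast, ← div_eq_mul_inv]
  rcases hη0.eq_or_lt with h0 | hpos
  · rw [← h0]; simp only [ne_eq, OfNat.ofNat_ne_zero, not_false_eq_true, zero_pow]; positivity
  have hmain := ghz_core W (ghzLift f) (ghzLift g)
    (Finset.univ.image fun z : X => - ghzLift h z)
    (Finset.card_image_le) (fun x y hw => by
      rw [ghzLift_win f g h _ _ _ hw.1 hw.2]
      exact Finset.mem_image_of_mem _ (Finset.mem_univ _))
    (ghzLift_inj2 f) (ghzLift_inj g) η hpos (by rw [hX]; positivity) hE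
  rw [hX] at hmain
  push_cast at hmain
  rw [le_div_iff₀ (by positivity)]
  refine le_trans ?_ hmain
  gcongr ?_ * _
  exact pow_le_pow_of_le_one hη0 hη1 (by norm_num)
end

section
/- (Balog–Szemerédi–Gowers) There exist constants c > 0 and C > 0 such that the following holds. Let G be an abelian group and let Γ ⊆ G be a finite set containing at least ξ|Γ|³ additive quadruples, i.e., |{(x,y,z,w) ∈ Γ⁴ : x + y = z + w}| ≥ ξ|Γ|³. Then there exists Γ' ⊆ Γ with |Γ'| ≥ c·ξ·|Γ| such that |Γ' − Γ'| ≤ C·ξ^{-4}·|Γ'|. -/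
/-- Representation set of `d` as a difference in `A`. -/
noncomputable def bsgRep {G : Type*} [AddCommGroup G] [DecidableEq G] (A : Finset G) (d : G) :
    Finset (G × G) := (A ×ˢ A).filter (fun p => p.1 - p.2 = d)

/-- The set `A ∩ (A + s)`. -/
noncomputable def bsgSh {G : Type*} [AddCommGroup G] [DecidableEq G] (A : Finset G) (s : G) :
    Finset G := A.filter (fun a => a - s ∈ A)

/-- The finset of differences. -/
noncomputable def bsgD {G : Type*} [AddCommGroup G] [DecidableEq G] (A : Finset G) :
    Finset G := (A ×ˢ A).image (fun p => p.1 - p.2)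

theorem bsg_sum_one {G : Type*} [AddCommGroup G] [DecidableEq G] (A : Finset G) :
    ∑ s ∈ bsgD A, (bsgSh A s).card ≤ A.card ^ 2 := by
  have h := Finset.sum_card_bipartiteAbove_eq_sum_card_bipartiteBelow (fun s a => a - s ∈ A)
    (s := bsgD A) (t := A)
  refine le_of_eq_of_le h ?_
  calc _ ≤ ∑ a ∈ A, A.card := by
        apply Finset.sum_le_sum
        intro a _
        apply Finset.card_le_card_of_injOn (fun s => a - s)
        · intro s hs
          simp [Finset.bipartiteBelow] at hs
          simpa using hs.2
        · intro s _ t _ h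
          simpa using h
    _ = _ := by simp [sq]

theorem bsg_sum_bad {G : Type*} [AddCommGroup G] [DecidableEq G] (A : Finset G)
    (P : G × G → Prop) [DecidablePred P] :
    ∑ s ∈ bsgD A, ((bsgSh A s ×ˢ bsgSh A s).filter P).card ≤
      ∑ p ∈ (A ×ˢ A).filter P, (bsgRep A (p.1 - p.2)).card := by
  have h := Finset.sum_card_bipartiteAbove_eq_sum_card_bipartiteBelow
    (fun s (p : G × G) => p.1 - s ∈ A ∧ p.2 - s ∈ A)
    (s := bsgD A) (t := (A ×ˢ A).filter P)
  have h2 : ∀ s, (bsgSh A s ×ˢ bsgSh A s).filter P =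
      Finset.bipartiteAbove (fun s (p : G × G) => p.1 - s ∈ A ∧ p.2 - s ∈ A)
        ((A ×ˢ A).filter P) s := by
    intro s
    ext p
    simp [bsgSh, Finset.bipartiteAbove]
    tauto
  simp only [h2]
  rw [h]
  apply Finset.sum_le_sum
  intro p _
  apply Finset.card_le_card_of_injOn (fun s => (p.1 - s, p.2 - s))
  · intro s hs
    simp [Finset.bipartiteBelow] at hs
    simp [bsgRep, hs.2]
  · intro s _ t _ h
    simpa using h

theorem bsg_energy {G : Type*} [AddCommGroup G] [DecidableEq G] (A : Finset G) :
    Nat.card {q : G × G × G × G //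
            q.1 ∈ A ∧ q.2.1 ∈ A ∧ q.2.2.1 ∈ A ∧ q.2.2.2 ∈ A ∧
              q.1 + q.2.1 = q.2.2.1 + q.2.2.2} ≤
    ∑ s ∈ bsgD A, (bsgSh A s).card ^ 2 := by
  have : ∑ s ∈ bsgD A, (bsgSh A s).card ^ 2 =
      ((bsgD A).sigma (fun s => bsgSh A s ×ˢ bsgSh A s)).card := by
    simp [Finset.card_sigma, sq]
  rw [this, ← Nat.card_eq_finsetCard]
  refine Nat.card_le_card_of_injective (fun q => ⟨⟨q.1.1 - q.1.2.2.1, (q.1.1, q.1.2.2.2)⟩, ?_⟩) ?_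
  · obtain ⟨⟨x, y, z, w⟩, hx, hy, hz, hw, h⟩ := q
    simp only at hx hy hz hw h
    have e : w - (x - z) = y := by
      have : w = x + y - z := by rw [h]; abel
      rw [this]; abel
    simp only [Finset.mem_sigma, Finset.mem_product, bsgSh, Finset.mem_filter, bsgD,
      Finset.mem_image, Prod.exists]
    refine ⟨⟨x, z, ⟨hx, hz⟩, rfl⟩, ⟨hx, by simpa using hz⟩, hw, by rw [e]; exact hy⟩
  · rintro ⟨⟨x, y, z, w⟩, hx, hy, hz, hw, h⟩ ⟨⟨x', y', z', w'⟩, hx', hy', hz', hw', h'⟩ he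
    simp only [Subtype.mk.injEq, Sigma.mk.injEq, heq_eq_eq, Prod.mk.injEq] at he h h' ⊢
    obtain ⟨h1, rfl, rfl⟩ := he
    have hz : z = z' := by simpa using h1
    subst hz
    refine ⟨rfl, ?_, rfl, rfl⟩
    exact add_left_cancel (h.trans h'.symm)

theorem bsg_count {G : Type*} [AddCommGroup G] [DecidableEq G] (A A' : Finset G) (k m : ℝ)
    (hm : 0 ≤ m)
    (H : ∀ a ∈ A', ∀ a' ∈ A', ∃ T : Finset G, k ≤ T.card ∧
      ∀ b ∈ T, m ≤ (bsgRep A (a - b)).card ∧ m ≤ (bsgRep A (a' - b)).card) :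
    ((bsgD A').card : ℝ) * (k * m ^ 2) ≤ (A.card : ℝ) ^ 4 := by
  classical
  let Q : Finset ((G × G) × (G × G)) := (A ×ˢ A) ×ˢ (A ×ˢ A)
  let f : (G × G) × (G × G) → G := fun q => (q.1.1 - q.1.2) - (q.2.1 - q.2.2)
  have hQ : (Q.card : ℝ) = (A.card : ℝ) ^ 4 := by simp [Q]; ring
  have h1 : ∑ d ∈ bsgD A', (Q.filter (fun q => f q = d)).card ≤ Q.card := by
    rw [← Finset.card_biUnion]
    · apply Finset.card_le_card
      intro q hq
      simp only [Finset.mem_biUnion, Finset.mem_filter] at hq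
      obtain ⟨_, _, h, _⟩ := hq
      exact h
    · intro x _ y _ hxy
      rw [Function.onFun, Finset.disjoint_left]
      intro q hq hq'
      simp only [Finset.mem_filter] at hq hq'
      exact hxy (hq.2.symm.trans hq'.2)
  have h2 : ∀ d ∈ bsgD A', k * m ^ 2 ≤ ((Q.filter (fun q => f q = d)).card : ℝ) := by
    intro d hd
    simp only [bsgD, Finset.mem_image, Finset.mem_product, Prod.exists] at hd
    obtain ⟨a, a', ⟨ha, ha'⟩, rfl⟩ := hd
    obtain ⟨T, hT, hb⟩ := H a ha a' ha'
    have h3 : ∑ b ∈ T, (bsgRep A (a - b) ×ˢ bsgRep A (a' - b)).card ≤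
        (Q.filter (fun q => f q = a - a')).card := by
      rw [← Finset.card_biUnion]
      · apply Finset.card_le_card
        rintro ⟨⟨x, y⟩, z, w⟩ hq
        simp only [Finset.mem_biUnion, Finset.mem_filter, Finset.mem_product, bsgRep, Q, f] at hq ⊢
        obtain ⟨b, _, ⟨⟨h1, h2⟩, h3⟩, ⟨h4, h5⟩, h6⟩ := hq
        refine ⟨⟨⟨h1, h2⟩, h4, h5⟩, ?_⟩
        rw [h3, h6]; abel
      · intro x _ y _ hxy
        rw [Function.onFun, Finset.disjoint_left]
        intro q hq hq'
        simp only [Finset.mem_filter, Finset.mem_product, bsgRep] at hq hq'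
        have := hq.1.2.symm.trans hq'.1.2
        exact hxy (by simpa using this)
    calc k * m ^ 2 ≤ T.card * m ^ 2 := by gcongr
      _ = ∑ b ∈ T, m ^ 2 := by simp
      _ ≤ ∑ b ∈ T, ((bsgRep A (a - b) ×ˢ bsgRep A (a' - b)).card : ℝ) := by
        apply Finset.sum_le_sum
        intro b hbT
        obtain ⟨h1, h2⟩ := hb b hbT
        rw [Finset.card_product, sq]
        push_cast
        gcongr
      _ ≤ _ := by exact_mod_cast h3
  calc ((bsgD A').card : ℝ) * (k * m ^ 2) = ∑ d ∈ bsgD A', k * m ^ 2 := by simp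
    _ ≤ ∑ d ∈ bsgD A', ((Q.filter (fun q => f q = d)).card : ℝ) := Finset.sum_le_sum h2
    _ ≤ Q.card := by exact_mod_cast h1
    _ = _ := hQ

theorem bsg_markov {G : Type*} [DecidableEq G] (B : Finset G) (P : G × G → Prop)
    [DecidablePred P] (h : 8 * ((B ×ˢ B).filter P).card ≤ B.card ^ 2) (hB : 0 < B.card) :
    B.card ≤ 2 * (B.filter (fun a => 4 * (B.filter (fun b => P (a, b))).card ≤ B.card)).card := by
  have h1 : ((B ×ˢ B).filter P).card = ∑ a ∈ B, (B.filter (fun b => P (a, b))).card := by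
    rw [Finset.card_filter, Finset.sum_product]
    simp only [Finset.card_filter]
  have h2 := Finset.card_filter_add_card_filter_not (s := B)
    (fun a => 4 * (B.filter (fun b => P (a, b))).card ≤ B.card)
  set X := B.filter (fun a => ¬ 4 * (B.filter (fun b => P (a, b))).card ≤ B.card) with hX
  have h3 : X.card * B.card ≤ 4 * ∑ a ∈ B, (B.filter (fun b => P (a, b))).card := by
    calc X.card * B.card = ∑ a ∈ X, B.card := by simp
      _ ≤ ∑ a ∈ X, 4 * (B.filter (fun b => P (a, b))).card := by
        apply Finset.sum_le_sum
        intro a ha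
        simp only [hX, Finset.mem_filter] at ha
        omega
      _ ≤ ∑ a ∈ B, 4 * (B.filter (fun b => P (a, b))).card :=
        Finset.sum_le_sum_of_subset (Finset.filter_subset _ _)
      _ = _ := by rw [Finset.mul_sum]
  have h4 : 2 * X.card ≤ B.card := by
    apply Nat.le_of_mul_le_mul_right _ hB
    rw [← h1] at h3
    nlinarith
  omega

theorem bsg_pick {G : Type*} [AddCommGroup G] [DecidableEq G] (A : Finset G) (ξ : ℝ)
    (hA : 0 < A.card) (hξ : 0 < ξ) (P : G × G → Prop) [DecidablePred P]
    (hP : ∀ p, P p → ((bsgRep A (p.1 - p.2)).card : ℝ) ≤ ξ / 16 * A.card)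
    (hE : ξ * (A.card : ℝ) ^ 3 ≤ ∑ s ∈ bsgD A, ((bsgSh A s).card : ℝ) ^ 2) :
    ∃ s, ξ / 2 * A.card ≤ (bsgSh A s).card ∧
      8 * ((bsgSh A s ×ˢ bsgSh A s).filter P).card ≤ (bsgSh A s).card ^ 2 ∧
      0 < (bsgSh A s).card := by
  have hA' : (0 : ℝ) < A.card := by exact_mod_cast hA
  have h1 : ∑ s ∈ bsgD A, ((bsgSh A s).card : ℝ) ≤ (A.card : ℝ) ^ 2 := by
    exact_mod_cast bsg_sum_one A
  have h2 : ∑ s ∈ bsgD A, (((bsgSh A s ×ˢ bsgSh A s).filter P).card : ℝ) ≤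
      ξ / 16 * (A.card : ℝ) ^ 3 := by
    calc _ ≤ ∑ p ∈ (A ×ˢ A).filter P, ((bsgRep A (p.1 - p.2)).card : ℝ) := by
          exact_mod_cast bsg_sum_bad A P
      _ ≤ ∑ p ∈ (A ×ˢ A).filter P, ξ / 16 * A.card := by
          apply Finset.sum_le_sum
          intro p hp
          exact hP p (Finset.mem_filter.1 hp).2
      _ ≤ ∑ p ∈ (A ×ˢ A), ξ / 16 * A.card := by
          apply Finset.sum_le_sum_of_subset_of_nonneg (Finset.filter_subset _ _)
          intros; positivity
      _ = _ := by simp; ring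
  have hne : (bsgD A).Nonempty := by
    obtain ⟨a, ha⟩ := Finset.card_pos.1 hA
    exact ⟨a - a, Finset.mem_image.2 ⟨(a, a), by simp [ha], rfl⟩⟩
  have h3 : ∑ s ∈ bsgD A, (ξ / 2 * A.card * ((bsgSh A s).card : ℝ)) ≤
      ∑ s ∈ bsgD A, (((bsgSh A s).card : ℝ) ^ 2
        - 8 * (((bsgSh A s ×ˢ bsgSh A s).filter P).card : ℝ)) := by
    rw [Finset.sum_sub_distrib, ← Finset.mul_sum, ← Finset.mul_sum]
    have : ξ / 2 * A.card * ∑ s ∈ bsgD A, ((bsgSh A s).card : ℝ) ≤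
      ξ / 2 * A.card * (A.card : ℝ) ^ 2 := by gcongr
    nlinarith
  have h4 : ∃ s ∈ bsgD A, ξ / 2 * A.card * ((bsgSh A s).card : ℝ) ≤ ((bsgSh A s).card : ℝ) ^ 2
        - 8 * (((bsgSh A s ×ˢ bsgSh A s).filter P).card : ℝ) := Finset.exists_le_of_sum_le hne h3
  obtain ⟨s, hs, h⟩ := h4
  have hpos : 0 < (bsgSh A s).card := by
    simp only [bsgD, Finset.mem_image, Finset.mem_product, Prod.exists] at hs
    obtain ⟨x, y, ⟨hx, hy⟩, rfl⟩ := hs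
    exact Finset.card_pos.2 ⟨x, by simp [bsgSh, hx, hy]⟩
  have hpos' : (0 : ℝ) < (bsgSh A s).card := by exact_mod_cast hpos
  refine ⟨s, ?_, ?_, hpos⟩
  · apply le_of_mul_le_mul_right _ hpos'
    have : (0 : ℝ) ≤ (((bsgSh A s ×ˢ bsgSh A s).filter P).card : ℝ) := by positivity
    nlinarith
  · have : 0 ≤ ξ / 2 * A.card * ((bsgSh A s).card : ℝ) := by positivity
    have h5 : 8 * (((bsgSh A s ×ˢ bsgSh A s).filter P).card : ℝ) ≤ ((bsgSh A s).card : ℝ) ^ 2 := by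
      linarith
    exact_mod_cast h5


/-- **Balog–Szemerédi–Gowers.** There are constants `c, C > 0` such that for every abelian
group `G` and every finite `Γ ⊆ G` with at least `ξ|Γ|³` additive quadruples
(solutions in `Γ⁴` of `x + y = z + w`), there exists `Γ' ⊆ Γ` with `|Γ'| ≥ c·ξ·|Γ|` and
`|Γ' − Γ'| ≤ C·ξ⁻⁴·|Γ'|`. -/
theorem balog_szemeredi_gowers :
    ∃ c C : ℝ, 0 < c ∧ 0 < C ∧
      ∀ (G : Type*) [AddCommGroup G] (Γ : Finset G) (ξ : ℝ), 0 < ξ → ξ ≤ 1 →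
        ξ * (Γ.card : ℝ) ^ 3 ≤
          (Nat.card {q : G × G × G × G //
            q.1 ∈ Γ ∧ q.2.1 ∈ Γ ∧ q.2.2.1 ∈ Γ ∧ q.2.2.2 ∈ Γ ∧
              q.1 + q.2.1 = q.2.2.1 + q.2.2.2} : ℝ) →
        ∃ Γ' : Finset G, Γ' ⊆ Γ ∧ c * ξ * (Γ.card : ℝ) ≤ (Γ'.card : ℝ) ∧
          (Nat.card {d : G // ∃ a ∈ Γ', ∃ b ∈ Γ', d = a - b} : ℝ) ≤
            C * ξ⁻¹ ^ 4 * (Γ'.card : ℝ) := by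
  refine ⟨1 / 4, 4096, by norm_num, by norm_num, ?_⟩
  intro G _ A ξ hξ _ hE
  classical
  rcases Nat.eq_zero_or_pos A.card with hA | hA
  · refine ⟨∅, by simp, by simp [hA], ?_⟩
    simp
  have hA' : (0 : ℝ) < A.card := by exact_mod_cast hA
  let P : G × G → Prop := fun p => ((bsgRep A (p.1 - p.2)).card : ℝ) ≤ ξ / 16 * A.card
  obtain ⟨s, hs1, hs2, hs3⟩ := bsg_pick A ξ hA hξ P (fun _ h => h)
    (hE.trans (by exact_mod_cast bsg_energy A))
  set B := bsgSh A s with hB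
  have hmk := bsg_markov B P hs2 hs3
  set A' := B.filter (fun a => 4 * (B.filter (fun b => P (a, b))).card ≤ B.card) with hA'def
  have hmk' : (B.card : ℝ) ≤ 2 * A'.card := by exact_mod_cast hmk
  have hBpos : (0 : ℝ) < B.card := by exact_mod_cast hs3
  refine ⟨A', (Finset.filter_subset _ _).trans (Finset.filter_subset _ _), by linarith, ?_⟩
  have hcard : Nat.card {d : G // ∃ a ∈ A', ∃ b ∈ A', d = a - b} = (bsgD A').card := by
    rw [← Nat.card_eq_finsetCard]
    apply Nat.card_congr
    apply Equiv.subtypeEquivRight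
    intro d
    simp only [bsgD, Finset.mem_image, Finset.mem_product, Prod.exists]
    constructor
    · rintro ⟨a, ha, b, hb, rfl⟩
      exact ⟨a, b, ⟨ha, hb⟩, rfl⟩
    · rintro ⟨a, b, ⟨ha, hb⟩, rfl⟩
      exact ⟨a, ha, b, hb, rfl⟩
  rw [hcard]
  have hc := bsg_count A A' (B.card / 2) (ξ / 16 * A.card) (by positivity) (by
    intro a ha a' ha'
    have ha2 := (Finset.mem_filter.1 ha).2
    have ha2' := (Finset.mem_filter.1 ha').2
    refine ⟨B \ (B.filter (fun b => P (a, b)) ∪ B.filter (fun b => P (a', b))), ?_, ?_⟩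
    · have h1 := Finset.card_union_le (B.filter (fun b => P (a, b))) (B.filter (fun b => P (a', b)))
      have h2 := Finset.le_card_sdiff
        (B.filter (fun b => P (a, b)) ∪ B.filter (fun b => P (a', b))) B
      have h3 : B.card ≤
        2 * (B \ (B.filter (fun b => P (a, b)) ∪ B.filter (fun b => P (a', b)))).card := by omega
      have h4 : (B.card : ℝ) ≤
        2 * ((B \ (B.filter (fun b => P (a, b)) ∪ B.filter (fun b => P (a', b)))).card : ℝ) := by
        exact_mod_cast h3
      linarith
    · intro b hb
      simp only [Finset.mem_sdiff, Finset.mem_union, Finset.mem_filter, not_or, not_and] at hb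
      exact ⟨le_of_lt (not_le.1 (hb.2.1 hb.1)), le_of_lt (not_le.1 (hb.2.2 hb.1))⟩)
  set D : ℝ := ((bsgD A').card : ℝ)
  set n : ℝ := (A.card : ℝ)
  set β : ℝ := (B.card : ℝ)
  set α : ℝ := (A'.card : ℝ)
  have hD : 0 ≤ D := Nat.cast_nonneg _
  have hc1 : D * β * ξ ^ 2 ≤ 512 * n ^ 2 := by
    have : (D * β * ξ ^ 2) * n ^ 2 ≤ (512 * n ^ 2) * n ^ 2 := by nlinarith
    exact le_of_mul_le_mul_right this (by positivity)
  have hn : ξ ^ 2 * n ^ 2 ≤ 4 * β ^ 2 := by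
    have : (ξ / 2 * n) ^ 2 ≤ β ^ 2 := by gcongr
    nlinarith
  have hc2 : D * ξ ^ 4 ≤ 2048 * β := by
    have : (D * ξ ^ 4) * β ≤ (2048 * β) * β := by
      have := mul_le_mul_of_nonneg_left hc1 (sq_nonneg ξ)
      nlinarith
    exact le_of_mul_le_mul_right this hBpos
  have : D * ξ ^ 4 ≤ 4096 * α := by linarith
  rw [inv_pow, mul_right_comm, ← div_eq_mul_inv, le_div_iff₀ (by positivity)]
  exact this
end

section
/- There is a constant c > 0 such that the following holds. Let n ∈ ℕ and suppose that φ : (ℤ/2ℤ)^n → (ℤ/4ℤ)^n has at least ξ · 2^{3n} additive quadruples. Then there exists a subset A ⊆ (ℤ/2ℤ)^n with |A| ≥ c · ξ^{257} · 2^n such that the restriction φ|_A is a Freiman homomorphism of order 8. -/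
/-- `φ` restricted to `A` is a Freiman homomorphism of order `k`: whenever
`a₁ + … + a_k = b₁ + … + b_k` with all `aᵢ, bᵢ ∈ A`, also
`φ(a₁) + … + φ(a_k) = φ(b₁) + … + φ(b_k)`. -/
def IsFreimanHomOn {G B : Type*} [AddCommMonoid G] [AddCommMonoid B]
    (k : ℕ) (A : Set G) (φ : G → B) : Prop :=
  ∀ a b : Fin k → G, (∀ i, a i ∈ A) → (∀ i, b i ∈ A) →
    (∑ i, a i) = (∑ i, b i) → (∑ i, φ (a i)) = (∑ i, φ (b i))

open Finset in
open Classical in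
lemma graph_core {V : Type*} [Fintype V] [Nonempty V] (adj : V → V → Prop) (δ : ℝ) (hδ : 0 < δ)
    (h : δ * (Fintype.card V : ℝ) ^ 2 ≤ ∑ b : V, (#{a : V | adj a b} : ℝ)) :
    ∃ A : Finset V, δ * Fintype.card V / 4 ≤ (#A : ℝ) ∧ ∀ a ∈ A, ∀ a' ∈ A,
      δ * Fintype.card V / 4 ≤ (#{c : V |
        δ ^ 2 * Fintype.card V / 16 ≤ (#{b : V | adj a b ∧ adj c b} : ℝ) ∧
        δ ^ 2 * Fintype.card V / 16 ≤ (#{b : V | adj a' b ∧ adj c b} : ℝ)} : ℝ) := by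
  set N : ℝ := (Fintype.card V : ℝ) with hN
  have hNpos : 0 < N := by rw [hN]; exact_mod_cast Fintype.card_pos
  set good : V → V → Prop := fun a c => δ ^ 2 * N / 16 ≤ (#{b : V | adj a b ∧ adj c b} : ℝ)
    with hgood
  set D : V → Finset V := fun b => {a : V | adj a b} with hD
  set β : V → Finset (V × V) := fun b =>
    ({p : V × V | ¬ good p.1 p.2} : Finset (V × V)).filter (fun p => adj p.1 b ∧ adj p.2 b) with hβ
  have hbad : ∑ b : V, (#(β b) : ℝ) ≤ N ^ 2 * (δ ^ 2 * N / 16) := by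
    have e := Finset.sum_card_bipartiteAbove_eq_sum_card_bipartiteBelow
      (s := ({p : V × V | ¬ good p.1 p.2} : Finset (V × V))) (t := (univ : Finset V))
      (fun p b => adj p.1 b ∧ adj p.2 b)
    have e' : ∑ b : V, (#(β b) : ℝ) =
        ∑ p ∈ ({p : V × V | ¬ good p.1 p.2} : Finset (V × V)),
          (#{b : V | adj p.1 b ∧ adj p.2 b} : ℝ) := by
      have := congrArg (Nat.cast : ℕ → ℝ) e.symm
      push_cast at this
      exact this
    rw [e']
    calc _ ≤ ∑ p ∈ ({p : V × V | ¬ good p.1 p.2} : Finset (V × V)), (δ ^ 2 * N / 16) := by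
          apply Finset.sum_le_sum
          intro p hp
          have := (Finset.mem_filter.1 hp).2
          exact (not_le.1 this).le
      _ = (#({p : V × V | ¬ good p.1 p.2} : Finset (V × V)) : ℝ) * (δ ^ 2 * N / 16) := by
          rw [Finset.sum_const, nsmul_eq_mul]
      _ ≤ _ := by
          gcongr
          have : #({p : V × V | ¬ good p.1 p.2} : Finset (V × V)) ≤ Fintype.card (V × V) :=
            Finset.card_le_univ _
          rw [Fintype.card_prod] at this
          calc _ ≤ ((Fintype.card V * Fintype.card V : ℕ) : ℝ) := by exact_mod_cast this
            _ = N ^ 2 := by push_cast; ring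
  have hsq : δ ^ 2 * N ^ 3 ≤ ∑ b : V, (#(D b) : ℝ) ^ 2 := by
    have cs := sq_sum_le_card_mul_sum_sq (s := (univ : Finset V)) (f := fun b => (#(D b) : ℝ))
    rw [Finset.card_univ, ← hN] at cs
    have h2 : (δ * N ^ 2) ^ 2 ≤ (∑ b : V, (#(D b) : ℝ)) ^ 2 := by
      apply pow_le_pow_left₀ (by positivity) h
    have : N * (δ ^ 2 * N ^ 3) ≤ N * ∑ b : V, (#(D b) : ℝ) ^ 2 := by
      calc _ = (δ * N ^ 2) ^ 2 := by ring
        _ ≤ _ := h2.trans cs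
    exact le_of_mul_le_mul_left this hNpos
  obtain ⟨b, -, hb⟩ : ∃ b ∈ (univ : Finset V),
      δ ^ 2 * N ^ 2 / 2 ≤ (#(D b) : ℝ) ^ 2 - 8 * (#(β b) : ℝ) := by
    apply Finset.exists_le_of_sum_le Finset.univ_nonempty
    rw [Finset.sum_const, nsmul_eq_mul, Finset.card_univ, ← hN, Finset.sum_sub_distrib,
      ← Finset.mul_sum]
    nlinarith
  set m : ℝ := (#(D b) : ℝ) with hm
  have hm0 : 0 ≤ m := by positivity
  have hmδ : δ * N / 2 ≤ m := by
    have : (δ * N / 2) ^ 2 ≤ m ^ 2 := by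
      have : (0 : ℝ) ≤ #(β b) := by positivity
      nlinarith [sq_nonneg (δ * N)]
    exact le_of_sq_le_sq this hm0
  have hmpos : 0 < m := lt_of_lt_of_le (by positivity) hmδ
  have hβm : (#(β b) : ℝ) ≤ m ^ 2 / 8 := by
    have : 0 ≤ δ ^ 2 * N ^ 2 / 2 := by positivity
    linarith
  set A : Finset V := (D b).filter (fun a => (#((D b).filter (fun c => ¬ good a c)) : ℝ) ≤ m / 4)
    with hA
  set A' : Finset V := (D b).filter
    (fun a => ¬ (#((D b).filter (fun c => ¬ good a c)) : ℝ) ≤ m / 4) with hA'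
  have hsum : (#A : ℝ) + #A' = m := by
    rw [hm]; exact_mod_cast Finset.card_filter_add_card_filter_not _
  have hA'card : (#A' : ℝ) * (m / 4) ≤ #(β b) := by
    have : #(A'.sigma (fun a => (D b).filter (fun c => ¬ good a c))) ≤ #(β b) := by
      apply Finset.card_le_card_of_injOn (fun p => (p.1, p.2))
      · rintro ⟨x, y⟩ hxy
        simp only [hA', hD, hβ, coe_sigma, Set.mem_sigma_iff, mem_filter, mem_univ,
          true_and, coe_filter, Set.mem_ofPred_eq] at hxy ⊢
        tauto
      · rintro ⟨x, y⟩ _ ⟨x', y'⟩ _ h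
        simp at h
        simp [h.1, h.2]
    rw [Finset.card_sigma] at this
    calc (#A' : ℝ) * (m / 4) = ∑ a ∈ A', m / 4 := by rw [Finset.sum_const, nsmul_eq_mul]
      _ ≤ ∑ a ∈ A', (#((D b).filter (fun c => ¬ good a c)) : ℝ) := by
        apply Finset.sum_le_sum
        intro a ha
        exact (not_le.1 (Finset.mem_filter.1 ha).2).le
      _ ≤ _ := by exact_mod_cast this
  have hA'm : (#A' : ℝ) ≤ m / 2 := by
    have : (#A' : ℝ) * (m / 4) ≤ (m / 2) * (m / 4) := by nlinarith
    exact le_of_mul_le_mul_right this (by positivity)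
  refine ⟨A, by linarith, ?_⟩
  intro a ha a' ha'
  have h1 := (Finset.mem_filter.1 ha).2
  have h2 := (Finset.mem_filter.1 ha').2
  have hcov : D b ⊆ ({c : V | good a c ∧ good a' c} : Finset V) ∪
      ((D b).filter (fun c => ¬ good a c) ∪ (D b).filter (fun c => ¬ good a' c)) := by
    intro c hc
    simp only [mem_union, mem_filter, mem_univ, true_and, hc]
    tauto
  have h3 := (Finset.card_le_card hcov).trans ((Finset.card_union_le _ _).trans
    (Nat.add_le_add_left (Finset.card_union_le _ _) _))
  have h4 : m ≤ (#({c : V | good a c ∧ good a' c} : Finset V) : ℝ) +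
    ((#((D b).filter (fun c => ¬ good a c)) : ℝ) + #((D b).filter (fun c => ¬ good a' c))) := by
    rw [hm]; exact_mod_cast h3
  have : m / 2 ≤ (#({c : V | good a c ∧ good a' c} : Finset V) : ℝ) := by linarith
  linarith

/-- number of representations -/
noncomputable def repCount {X H : Type*} [Fintype X] (g : X → H) (h : H) : ℕ := by
  classical exact (Finset.univ.filter (fun x => g x = h)).card

open Finset in
lemma repCount_conv {X Y H ι : Type*} [Fintype X] [Fintype Y] [AddCommGroup H]
    (g : X → H) (k : Y → H) (I : Finset ι) (e : ι → H) (he : Set.InjOn e I) (d : H) :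
    ∑ i ∈ I, repCount g (e i) * repCount k (d - e i) ≤
      repCount (fun p : X × Y => g p.1 + k p.2) d := by
  classical
  unfold repCount
  simp_rw [← Finset.card_product]
  rw [← Finset.card_sigma]
  apply Finset.card_le_card_of_injOn (fun p => p.2)
  · rintro ⟨i, x, y⟩ h
    simp at h ⊢
    rw [h.2.1, h.2.2]; abel
  · rintro ⟨i, x, y⟩ h ⟨i', x', y'⟩ h' heq
    simp at h h' heq
    obtain ⟨rfl, rfl⟩ := heq
    have : i = i' := he h.1 h'.1 (h.2.1.symm.trans h'.2.1)
    subst this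
    rfl

lemma repCount_sum_le {X H : Type*} [Fintype X] (g : X → H) (D : Finset H) :
    ∑ d ∈ D, repCount g d ≤ Fintype.card X := by
  classical
  unfold repCount
  rw [← Finset.card_univ (α := X), ← Finset.card_biUnion]
  · exact Finset.card_le_card (Finset.subset_univ _)
  · intro a _ b _ hab
    rw [Function.onFun, Finset.disjoint_left]
    intro x hx hx'
    simp at hx hx'
    exact hab (hx.symm.trans hx')

lemma repCount_neg {X H : Type*} [Fintype X] [AddCommGroup H] (g : X → H) (h : H) :
    repCount (fun x => - g x) (-h) = repCount g h := by
  unfold repCount; congr 1; ext; simp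

open Finset Classical in
lemma bsg_core {V H : Type*} [Fintype V] [Nonempty V] [DecidableEq H] [AddCommGroup H] (f : V → H)
    (hf : Function.Injective f) (δ : ℝ) (hδ : 0 < δ)
    (h : 2 * δ * (Fintype.card V : ℝ) ^ 3 ≤
      ∑ y : V, ∑ x : V, (repCount (fun p : V × V => f p.1 + f p.2) (f x + f y) : ℝ)) :
    ∃ A : Finset V, δ * Fintype.card V / 4 ≤ (#A : ℝ) ∧
      (#((A ×ˢ A).image (fun p => f p.1 - f p.2)) : ℝ) * δ ^ 9 ≤ 1024 * Fintype.card V := by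
  set N : ℝ := (Fintype.card V : ℝ) with hN
  have hNpos : 0 < N := by rw [hN]; exact_mod_cast Fintype.card_pos
  set s : V × V → H := fun p => f p.1 + f p.2 with hs
  set adj : V → V → Prop := fun x y => δ * N ≤ (repCount s (f x + f y) : ℝ) with hadj
  have hrle : ∀ z, (repCount s z : ℝ) ≤ N := by
    intro z
    have : repCount s z ≤ Fintype.card V := by
      unfold repCount
      rw [← Finset.card_univ]
      apply Finset.card_le_card_of_injOn (fun p => p.1) (by simp)
      rintro ⟨a, b⟩ h ⟨a', b'⟩ h' heq
      simp [hs] at h h' heq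
      subst heq
      have : f b = f b' := by
        have := h.trans h'.symm
        exact add_left_cancel this
      rw [hf this]
    rw [hN]; exact_mod_cast this
  have hdeg : δ * N ^ 2 ≤ ∑ b : V, (#{a : V | adj a b} : ℝ) := by
    have hb : ∀ y : V, ∑ x : V, (repCount s (f x + f y) : ℝ) ≤
        N * (#{a : V | adj a y} : ℝ) + δ * N ^ 2 := by
      intro y
      calc _ ≤ ∑ x : V, ((if adj x y then N else 0) + δ * N) := by
            apply Finset.sum_le_sum
            intro x _
            split_ifs with hx
            · have := hrle (f x + f y)
              have : 0 < δ * N := by positivity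
              linarith
            · have := (not_le.1 hx).le
              linarith
        _ = _ := by
            rw [Finset.sum_add_distrib, Finset.sum_const, ← Finset.sum_filter, Finset.sum_const,
              nsmul_eq_mul, nsmul_eq_mul, Finset.card_univ, ← hN]
            ring
    have h2 := h.trans (Finset.sum_le_sum (fun y _ => hb y))
    rw [Finset.sum_add_distrib, ← Finset.mul_sum, Finset.sum_const, nsmul_eq_mul,
      Finset.card_univ, ← hN] at h2
    have : N * (δ * N ^ 2) ≤ N * ∑ b : V, (#{a : V | adj a b} : ℝ) := by
      nlinarith
    exact le_of_mul_le_mul_left this hNpos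
  obtain ⟨A, hA, hAA⟩ := graph_core adj δ hδ hdeg
  refine ⟨A, hA, ?_⟩
  rw [← hN] at hAA
  set M : (V × V) × (V × V) → H := fun p => s p.1 + - s p.2 with hM
  have hMgood : ∀ a c, δ ^ 2 * N / 16 ≤ (#{b : V | adj a b ∧ adj c b} : ℝ) →
      δ ^ 4 * N ^ 3 / 16 ≤ (repCount M (f a - f c) : ℝ) ∧
      δ ^ 4 * N ^ 3 / 16 ≤ (repCount M (f c - f a) : ℝ) := by
    have key : ∀ a c, δ ^ 2 * N / 16 ≤ (#{b : V | adj a b ∧ adj c b} : ℝ) →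
      δ ^ 4 * N ^ 3 / 16 ≤ (repCount M (f a - f c) : ℝ) := by
      intro a c hac
      have h1 := repCount_conv s (fun x => - s x) ({b : V | adj a b ∧ adj c b} : Finset V)
        (fun b => f a + f b) (by intro x _ y _ hxy; exact hf (add_left_cancel hxy)) (f a - f c)
      have h2 : ∑ b ∈ ({b : V | adj a b ∧ adj c b} : Finset V), (δ * N) * (δ * N) ≤
          (repCount M (f a - f c) : ℝ) := by
        refine le_trans ?_ (Nat.cast_le.2 h1)
        push_cast
        apply Finset.sum_le_sum
        intro b hb
        obtain ⟨hb1, hb2⟩ := (Finset.mem_filter.1 hb).2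
        have : f a - f c - (f a + f b) = -(f c + f b) := by abel
        rw [this, repCount_neg]
        gcongr
      rw [Finset.sum_const, nsmul_eq_mul] at h2
      refine le_trans ?_ h2
      calc δ ^ 4 * N ^ 3 / 16 = (δ ^ 2 * N / 16) * ((δ * N) * (δ * N)) := by ring
        _ ≤ _ := by gcongr
    intro a c hac
    refine ⟨key a c hac, key c a ?_⟩
    simpa only [and_comm] using hac
  set D := (A ×ˢ A).image (fun p => f p.1 - f p.2) with hD
  have hT : ∀ d ∈ D, δ ^ 9 * N ^ 7 / 1024 ≤
      (repCount (fun p : ((V × V) × (V × V)) × ((V × V) × (V × V)) => M p.1 + M p.2) d : ℝ) := by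
    intro d hd
    obtain ⟨⟨a, a'⟩, haa, rfl⟩ := Finset.mem_image.1 hd
    rw [Finset.mem_product] at haa
    have hc := hAA a haa.1 a' haa.2
    set I : Finset V := {c : V |
        δ ^ 2 * N / 16 ≤ (#{b : V | adj a b ∧ adj c b} : ℝ) ∧
        δ ^ 2 * N / 16 ≤ (#{b : V | adj a' b ∧ adj c b} : ℝ)} with hI
    have h1 := repCount_conv M M I (fun c => f a - f c)
      (by intro x _ y _ hxy; exact hf (sub_right_injective hxy)) (f a - f a')
    refine le_trans ?_ (Nat.cast_le.2 h1)
    push_cast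
    calc δ ^ 9 * N ^ 7 / 1024 = (δ * N / 4) * ((δ ^ 4 * N ^ 3 / 16) * (δ ^ 4 * N ^ 3 / 16)) := by
          ring
      _ ≤ #I * ((δ ^ 4 * N ^ 3 / 16) * (δ ^ 4 * N ^ 3 / 16)) := by gcongr
      _ = ∑ c ∈ I, (δ ^ 4 * N ^ 3 / 16) * (δ ^ 4 * N ^ 3 / 16) := by
          rw [Finset.sum_const, nsmul_eq_mul]
      _ ≤ _ := by
          apply Finset.sum_le_sum
          intro c hcI
          obtain ⟨h1, h2⟩ := (Finset.mem_filter.1 hcI).2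
          have e : f a - f a' - (f a - f c) = f c - f a' := by abel
          rw [e]
          have := (hMgood a c h1).1
          have := (hMgood a' c h2).2
          gcongr
  have h3 := repCount_sum_le
    (fun p : ((V × V) × (V × V)) × ((V × V) × (V × V)) => M p.1 + M p.2) D
  have h4 : (#D : ℝ) * (δ ^ 9 * N ^ 7 / 1024) ≤ N ^ 8 := by
    calc _ = ∑ d ∈ D, δ ^ 9 * N ^ 7 / 1024 := by rw [Finset.sum_const, nsmul_eq_mul]
      _ ≤ ∑ d ∈ D, (repCount
        (fun p : ((V × V) × (V × V)) × ((V × V) × (V × V)) => M p.1 + M p.2) d : ℝ) :=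
          Finset.sum_le_sum hT
      _ ≤ (Fintype.card (((V × V) × (V × V)) × ((V × V) × (V × V))) : ℝ) := by exact_mod_cast h3
      _ = N ^ 8 := by simp only [Fintype.card_prod]; push_cast; ring
  have : (#D * δ ^ 9) * N ^ 7 ≤ (1024 * N) * N ^ 7 := by nlinarith
  exact le_of_mul_le_mul_right this (by positivity)
open Finset in
lemma exists_char {n : ℕ} (Y : Finset (Fin n → ZMod 4)) (hY : ∀ y ∈ Y, y ≠ 0 ∧ y + y = 0) :
    ∃ t : Fin n → ZMod 4, 2 * #{y ∈ Y | ∑ i, t i * y i = 0} ≤ #Y := by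
  classical
  have hy : ∀ y ∈ Y, 2 * #{t : Fin n → ZMod 4 | ∑ i, t i * y i = 0} ≤
      Fintype.card (Fin n → ZMod 4) := by
    intro y hyY
    obtain ⟨h0, h2⟩ := hY y hyY
    obtain ⟨j, hj⟩ : ∃ j, y j ≠ 0 := by
      by_contra! hc
      exact h0 (funext hc)
    have hle : #{t : Fin n → ZMod 4 | ∑ i, t i * y i = 0} ≤
        #{t : Fin n → ZMod 4 | ¬ ∑ i, t i * y i = 0} := by
      apply Finset.card_le_card_of_injOn (fun t => t + Pi.single j 1)
      · intro t ht
        simp only [coe_filter, mem_univ, true_and, Set.mem_ofPred_eq] at ht ⊢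
        simp only [Pi.add_apply, add_mul, Finset.sum_add_distrib, ht, zero_add]
        simpa [Pi.single_apply] using hj
      · intro t _ t' _ h
        simpa using h
    have := Finset.card_filter_add_card_filter_not (s := (univ : Finset (Fin n → ZMod 4)))
      (fun t => ∑ i, t i * y i = 0)
    rw [Finset.card_univ] at this
    omega
  by_contra! hc
  have e := Finset.sum_card_bipartiteAbove_eq_sum_card_bipartiteBelow
      (s := Y) (t := (univ : Finset (Fin n → ZMod 4))) (fun y t => ∑ i, t i * y i = 0)
  have h1 : ∑ y ∈ Y, 2 * #{t : Fin n → ZMod 4 | ∑ i, t i * y i = 0} ≤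
      #Y * Fintype.card (Fin n → ZMod 4) := by
    rw [← smul_eq_mul, ← Finset.sum_const]
    exact Finset.sum_le_sum hy
  have h2 : #Y * Fintype.card (Fin n → ZMod 4) <
      ∑ t : Fin n → ZMod 4, 2 * #{y ∈ Y | ∑ i, t i * y i = 0} := by
    rw [mul_comm, ← smul_eq_mul, ← Finset.card_univ, ← Finset.sum_const]
    exact Finset.sum_lt_sum_of_nonempty Finset.univ_nonempty (fun t _ => hc t)
  rw [← Finset.mul_sum] at h1 h2
  have e' : ∑ y ∈ Y, #{t : Fin n → ZMod 4 | ∑ i, t i * y i = 0} =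
    ∑ t : Fin n → ZMod 4, #{y ∈ Y | ∑ i, t i * y i = 0} := e
  omega

open Finset in
lemma avoid {n : ℕ} {V : Type*} (φ : V → (Fin n → ZMod 4)) (w : Fin n → ZMod 4) (m : ℕ) :
    ∀ (A : Finset V) (_ : ∀ a ∈ A, φ a + φ a = w)
    (Y : Finset (Fin n → ZMod 4)) (_ : ∀ y ∈ Y, y ≠ 0 ∧ y + y = 0) (_ : #Y ≤ m),
    ∃ A' ⊆ A, #A ≤ max 1 (2 * #Y) * #A' ∧
      ∀ a b : Fin 8 → V, (∀ i, a i ∈ A') → (∀ i, b i ∈ A') →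
        ∑ i, φ (a i) - ∑ i, φ (b i) ∉ Y := by
  classical
  induction m with
  | zero =>
    intro A _ Y _ hm
    have : Y = ∅ := by simpa using hm
    subst this
    exact ⟨A, subset_rfl, by simp, by simp⟩
  | succ m ih =>
    intro A hA Y hY hm
    rcases Y.eq_empty_or_nonempty with rfl | hne
    · exact ⟨A, subset_rfl, by simp, by simp⟩
    rcases A.eq_empty_or_nonempty with rfl | hAne
    · refine ⟨∅, subset_rfl, by simp, ?_⟩
      intro a b ha
      exact absurd (ha 0) (by simp)
    have hYpos := hne.card_pos
    obtain ⟨t, ht⟩ := exists_char Y hY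
    set χ : (Fin n → ZMod 4) →+ ZMod 4 :=
      { toFun := fun y => ∑ i, t i * y i
        map_zero' := by simp
        map_add' := by intro x y; simp [mul_add, Finset.sum_add_distrib] } with hχ
    have hχ' : ∀ y, χ y = ∑ i, t i * y i := fun _ => rfl
    obtain ⟨a0, ha0⟩ := hAne
    have hval : ∀ a ∈ A, χ (φ a) = χ (φ a0) ∨ χ (φ a) = χ (φ a0) + 2 := by
      intro a ha
      have h : χ (φ a) + χ (φ a) = χ (φ a0) + χ (φ a0) := by
        rw [← map_add, ← map_add, hA a ha, hA a0 ha0]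
      generalize χ (φ a) = p at *
      generalize χ (φ a0) = q at *
      revert p q; decide
    obtain ⟨v, hv⟩ : ∃ v, #A ≤ 2 * #{a ∈ A | χ (φ a) = v} := by
      by_contra! hc
      have h1 := hc (χ (φ a0))
      have h2 := hc (χ (φ a0) + 2)
      have : A ⊆ {a ∈ A | χ (φ a) = χ (φ a0)} ∪ {a ∈ A | χ (φ a) = χ (φ a0) + 2} := by
        intro a ha
        have := hval a ha
        simp only [mem_union, mem_filter, ha, true_and]
        exact this
      have := (Finset.card_le_card this).trans (Finset.card_union_le _ _)
      omega
    obtain ⟨A', hA', hcard, hav⟩ := ih {a ∈ A | χ (φ a) = v}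
      (fun a ha => hA a (Finset.mem_filter.1 ha).1) {y ∈ Y | ∑ i, t i * y i = 0}
      (fun y hy => hY y (Finset.mem_filter.1 hy).1) (by omega)
    refine ⟨A', hA'.trans (Finset.filter_subset _ _), ?_, ?_⟩
    · have : 2 * max 1 (2 * #{y ∈ Y | ∑ i, t i * y i = 0}) ≤ max 1 (2 * #Y) := by omega
      calc #A ≤ 2 * #{a ∈ A | χ (φ a) = v} := hv
        _ ≤ 2 * (max 1 (2 * #{y ∈ Y | ∑ i, t i * y i = 0}) * #A') := by gcongr
        _ = (2 * max 1 (2 * #{y ∈ Y | ∑ i, t i * y i = 0})) * #A' := by ring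
        _ ≤ _ := by gcongr
    · intro a b ha hb hmem
      refine hav a b ha hb (Finset.mem_filter.2 ⟨hmem, ?_⟩)
      rw [← hχ', map_sub, map_sum, map_sum,
        Finset.sum_congr rfl (fun i _ => (Finset.mem_filter.1 (hA' (ha i))).2),
        Finset.sum_congr rfl (fun i _ => (Finset.mem_filter.1 (hA' (hb i))).2), sub_self]

open Finset Pointwise in
lemma plu_sub {H : Type*} [DecidableEq H] [AddCommGroup H] (B : Finset H) (hB : B.Nonempty) (K : ℝ)
    (hK : (#(B - B) : ℝ) ≤ K * #B) (m k : ℕ) :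
    (#(m • B - k • B) : ℝ) ≤ K ^ (m + k) * #B := by
  have h := Finset.pluennecke_ruzsa_inequality_nsmul_sub_nsmul_sub hB B m k
  have h' : (#(m • B - k • B) : ℝ) ≤ ((#(B - B) : ℝ) / #B) ^ (m + k) * #B := by
    have h2 := (NNRat.cast_le (K := ℝ)).2 h
    push_cast at h2
    exact h2
  have hpos : (0 : ℝ) < #B := by exact_mod_cast hB.card_pos
  refine h'.trans ?_
  gcongr
  rwa [div_le_iff₀ hpos]

open Finset in
lemma fibre_bound {V M : Type*} [DecidableEq V] [DecidableEq M] [AddCommGroup V] [AddCommGroup M]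
    (φ : V → M) (A : Finset V) (T : Finset M) (S : Finset (V × M))
    (h : ∀ t ∈ T, ∀ a ∈ A, (a, t + φ a) ∈ S) : #T * #A ≤ #S := by
  rw [← Finset.card_product]
  apply Finset.card_le_card_of_injOn (fun p => (p.2, p.1 + φ p.2))
  · rintro ⟨t, a⟩ hta
    simp only [coe_product, Set.mem_prod, mem_coe] at hta
    exact h t hta.1 a hta.2
  · rintro ⟨t, a⟩ _ ⟨t', a'⟩ _ heq
    simp only [Prod.mk.injEq] at heq
    obtain ⟨rfl, h2⟩ := heq
    rw [add_right_cancel h2]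

open Finset Pointwise in
lemma sum_mem_nsmul {H : Type*} [DecidableEq H] [AddCommGroup H] (B : Finset H) (k : ℕ) :
    ∀ (g : Fin k → H) (_ : ∀ i, g i ∈ B), ∑ i, g i ∈ k • B := by
  induction k with
  | zero => intro g _; simp
  | succ k ih =>
    intro g hg
    rw [Fin.sum_univ_castSucc, succ_nsmul]
    exact Finset.add_mem_add (ih _ (fun i => hg _)) (hg _)

open Finset Pointwise in
lemma second_part {n : ℕ} (φ : (Fin n → ZMod 2) → (Fin n → ZMod 4)) (A : Finset (Fin n → ZMod 2))
    (hA : A.Nonempty) (K : ℝ) (hK1 : 1 ≤ K)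
    (hK : (#((A ×ˢ A).image (fun p => ((p.1, φ p.1) : (Fin n → ZMod 2) × (Fin n → ZMod 4))
      - (p.2, φ p.2))) : ℝ) ≤ K * #A) :
    ∃ A' : Finset (Fin n → ZMod 2), (#A : ℝ) ≤ K ^ 3 * (2 * K ^ 17) * #A' ∧
      IsFreimanHomOn 8 (A' : Set (Fin n → ZMod 2)) φ := by
  set f : (Fin n → ZMod 2) → (Fin n → ZMod 2) × (Fin n → ZMod 4) := fun x => (x, φ x) with hf
  have hfinj : Function.Injective f := fun x y h => (Prod.mk.inj h).1
  set B := A.image f with hB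
  have hBcard : #B = #A := Finset.card_image_of_injective _ hfinj
  have hBne : B.Nonempty := hA.image f
  have hApos : (0 : ℝ) < #A := by exact_mod_cast hA.card_pos
  have hBB : (#(B - B) : ℝ) ≤ K * #B := by
    rw [hBcard]
    refine le_trans ?_ hK
    apply Nat.cast_le.2
    apply Finset.card_le_card
    intro z hz
    obtain ⟨x, hx, y, hy, rfl⟩ := Finset.mem_sub.1 hz
    obtain ⟨a, ha, rfl⟩ := Finset.mem_image.1 hx
    obtain ⟨b, hb, rfl⟩ := Finset.mem_image.1 hy
    exact Finset.mem_image.2 ⟨(a, b), Finset.mem_product.2 ⟨ha, hb⟩, rfl⟩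
  have hmem : ∀ a ∈ A, f a ∈ B := fun a ha => Finset.mem_image_of_mem f ha
  set W := A.image (fun a => φ a + φ a) with hW
  have hWcard : (#W : ℝ) ≤ K ^ 3 := by
    have h1 : #W * #A ≤ #(3 • B - 0 • B) := by
      apply fibre_bound φ
      intro t ht a ha
      obtain ⟨b, hb, rfl⟩ := Finset.mem_image.1 ht
      have h3 := sum_mem_nsmul B 3 ![f b, f b, f a] (by
        intro i; fin_cases i <;> simp [hmem, ha, hb])
      have : b + b = 0 := by
        ext i
        simp only [Pi.add_apply, Pi.zero_apply]
        generalize b i = z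
        revert z; decide
      simp only [Fin.sum_univ_three, Matrix.cons_val_zero, Matrix.cons_val_one,
        Matrix.cons_val] at h3
      have e : f b + f b + f a = (a, φ b + φ b + φ a) := by
        simp [hf, this]
      rw [e] at h3
      simpa using h3
    have h2 := plu_sub B hBne K hBB 3 0
    rw [hBcard] at h2
    have h3 : (#W : ℝ) * #A ≤ K ^ 3 * #A := le_trans (by exact_mod_cast h1) h2
    exact le_of_mul_le_mul_right h3 hApos
  set Y : Finset (Fin n → ZMod 4) :=
    {y | (y ≠ 0 ∧ y + y = 0) ∧ ((0 : Fin n → ZMod 2), y) ∈ 8 • B - 8 • B} with hY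
  have hYcard : (#Y : ℝ) ≤ K ^ 17 := by
    have h1 : #Y * #A ≤ #(9 • B - 8 • B) := by
      apply fibre_bound φ
      intro t ht a ha
      obtain ⟨u, hu, v, hv, huv⟩ := Finset.mem_sub.1 (Finset.mem_filter.1 ht).2.2
      refine Finset.mem_sub.2 ⟨u + f a, ?_, v, hv, ?_⟩
      · rw [succ_nsmul]
        exact Finset.add_mem_add hu (hmem a ha)
      · rw [add_sub_right_comm, huv]
        simp [hf]
    have h2 := plu_sub B hBne K hBB 9 8
    rw [hBcard] at h2
    have h3 : (#Y : ℝ) * #A ≤ K ^ 17 * #A := le_trans (by exact_mod_cast h1) h2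
    exact le_of_mul_le_mul_right h3 hApos
  obtain ⟨w, hw, hwc⟩ : ∃ w ∈ W, #A ≤ #W * #{a ∈ A | φ a + φ a = w} := by
    by_contra! hc
    have h1 := Finset.card_eq_sum_card_image (fun a => φ a + φ a) A
    have h2 : ∑ w ∈ W, #W * #{a ∈ A | φ a + φ a = w} < ∑ w ∈ W, #A :=
      Finset.sum_lt_sum_of_nonempty (hA.image _) hc
    rw [← Finset.mul_sum, ← h1, Finset.sum_const, smul_eq_mul] at h2
    exact lt_irrefl _ h2
  obtain ⟨A', hA', hcard, hav⟩ := avoid φ w (#Y) {a ∈ A | φ a + φ a = w}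
    (fun a ha => (Finset.mem_filter.1 ha).2) Y (fun y hy => (Finset.mem_filter.1 hy).2.1) le_rfl
  refine ⟨A', ?_, ?_⟩
  · have hmax : ((max 1 (2 * #Y) : ℕ) : ℝ) ≤ 2 * K ^ 17 := by
      push_cast
      have : 1 ≤ K ^ 17 := one_le_pow₀ hK1
      exact max_le (by linarith) (by linarith)
    calc (#A : ℝ) ≤ #W * #{a ∈ A | φ a + φ a = w} := by exact_mod_cast hwc
      _ ≤ #W * ((max 1 (2 * #Y) : ℕ) * #A') := by
          gcongr
          exact_mod_cast hcard
      _ ≤ K ^ 3 * (2 * K ^ 17 * #A') := by gcongr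
      _ = _ := by ring
  · intro a b ha hb hab
    by_contra hne
    apply hav a b ha hb
    have hAa : ∀ x ∈ A', x ∈ A ∧ φ x + φ x = w := fun x hx => Finset.mem_filter.1 (hA' hx)
    refine Finset.mem_filter.2 ⟨Finset.mem_univ _, ⟨sub_ne_zero.2 hne, ?_⟩, ?_⟩
    · have : ∀ c : Fin 8 → (Fin n → ZMod 2), (∀ i, c i ∈ (A' : Set (Fin n → ZMod 2))) →
          ∑ i, φ (c i) + ∑ i, φ (c i) = ∑ _i : Fin 8, w := by
        intro c hc
        rw [← Finset.sum_add_distrib]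
        exact Finset.sum_congr rfl (fun i _ => (hAa _ (hc i)).2)
      rw [sub_add_sub_comm, this a ha, this b hb, sub_self]
    · have h1 := sum_mem_nsmul B 8 (fun i => f (a i)) (fun i => hmem _ (hAa _ (ha i)).1)
      have h2 := sum_mem_nsmul B 8 (fun i => f (b i)) (fun i => hmem _ (hAa _ (hb i)).1)
      refine Finset.mem_sub.2 ⟨_, h1, _, h2, ?_⟩
      ext1
      · simp [hf, Prod.fst_sum, hab]
      · simp [hf, Prod.snd_sum]

open Finset in
lemma quad_count {V M : Type*} [Fintype V] [AddCommGroup V] [AddCommGroup M] (φ : V → M) :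
    Nat.card {q : V × V × V × V // q.1 + q.2.1 = q.2.2.1 + q.2.2.2 ∧
        φ q.1 + φ q.2.1 = φ q.2.2.1 + φ q.2.2.2} ≤
      ∑ y : V, ∑ x : V, repCount (fun p : V × V => ((p.1, φ p.1) : V × M) + (p.2, φ p.2))
        ((x, φ x) + (y, φ y)) := by
  classical
  rw [Nat.card_eq_fintype_card, Fintype.card_subtype]
  unfold repCount
  simp_rw [← Finset.card_sigma]
  apply Finset.card_le_card_of_injOn (fun q => ⟨q.2.2.2, q.2.2.1, (q.1, q.2.1)⟩)
  · rintro ⟨a, b, c, d⟩ h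
    simp at h ⊢
    exact h
  · rintro ⟨a, b, c, d⟩ _ ⟨a', b', c', d'⟩ _ h
    simp at h
    simp [h]

/-- There is `c > 0` such that: if `φ : (ℤ/2ℤ)^n → (ℤ/4ℤ)^n` has at least `ξ · 2^(3n)`
additive quadruples, then there is `A ⊆ (ℤ/2ℤ)^n` with `|A| ≥ c · ξ^257 · 2^n` on which `φ`
is a Freiman homomorphism of order `8`. -/
theorem many_quadruples_to_freiman :
    ∃ c : ℝ, 0 < c ∧
      ∀ (n : ℕ) (φ : (Fin n → ZMod 2) → (Fin n → ZMod 4)) (ξ : ℝ), 0 < ξ → ξ ≤ 1 →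
        ξ * 2 ^ (3 * n) ≤
          (Nat.card {q : (Fin n → ZMod 2) × (Fin n → ZMod 2) ×
              (Fin n → ZMod 2) × (Fin n → ZMod 2) //
            q.1 + q.2.1 = q.2.2.1 + q.2.2.2 ∧
              φ q.1 + φ q.2.1 = φ q.2.2.1 + φ q.2.2.2} : ℝ) →
        ∃ A : Set (Fin n → ZMod 2),
          c * ξ ^ 257 * 2 ^ n ≤ (Nat.card A : ℝ) ∧ IsFreimanHomOn 8 A φ := by
  classical
  obtain ⟨P, hP⟩ : ∃ P : ℝ, P = 4194304 := ⟨_, rfl⟩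
  have hPpos : 0 < P := by rw [hP]; norm_num
  refine ⟨1 / (16 * P ^ 20), by positivity, ?_⟩
  intro n φ ξ hξ hξ1 hq
  have hcardV : (Fintype.card (Fin n → ZMod 2) : ℝ) = 2 ^ n := by
    simp [ZMod.card]
  have hN : (0 : ℝ) < 2 ^ n := by positivity
  have hq2 := hq.trans (Nat.cast_le.2 (quad_count φ))
  push_cast at hq2
  obtain ⟨A, hA, hAA⟩ := bsg_core (fun x => ((x, φ x) : (Fin n → ZMod 2) × (Fin n → ZMod 4)))
    (fun x y h => (Prod.mk.inj h).1) (ξ / 2) (by positivity) (by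
      rw [hcardV]
      calc 2 * (ξ / 2) * ((2 : ℝ) ^ n) ^ 3 = ξ * 2 ^ (3 * n) := by
            rw [← pow_mul, mul_comm n 3]; ring
        _ ≤ _ := hq2)
  rw [hcardV] at hA hAA
  have hApos : (0 : ℝ) < A.card := lt_of_lt_of_le (by positivity) hA
  have hAne : A.Nonempty := Finset.card_pos.1 (by exact_mod_cast hApos)
  have hK : (((A ×ˢ A).image (fun p => ((p.1, φ p.1) : (Fin n → ZMod 2) × (Fin n → ZMod 4))
      - (p.2, φ p.2))).card : ℝ) ≤ (P / ξ ^ 10) * A.card := by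
    rw [div_mul_eq_mul_div, le_div_iff₀ (by positivity), hP]
    have e : (((A ×ˢ A).image (fun p => ((p.1, φ p.1) : (Fin n → ZMod 2) × (Fin n → ZMod 4))
      - (p.2, φ p.2))).card : ℝ) * ξ ^ 9 ≤ 524288 * 2 ^ n := by
      have h512 : (ξ / 2) ^ 9 = ξ ^ 9 / 512 := by ring
      rw [h512] at hAA
      linarith
    have := mul_le_mul_of_nonneg_right e hξ.le
    nlinarith
  have hK1 : 1 ≤ P / ξ ^ 10 := by
    rw [le_div_iff₀ (by positivity), hP]
    have : ξ ^ 10 ≤ 1 := pow_le_one₀ hξ.le hξ1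
    linarith
  obtain ⟨A', hA', hF⟩ := second_part φ A hAne _ hK1 hK
  refine ⟨A', ?_, hF⟩
  have hcA : Nat.card (A' : Set (Fin n → ZMod 2)) = A'.card := by simp
  rw [hcA]
  have h1 : ξ / 8 * 2 ^ n ≤ 2 * P ^ 20 / ξ ^ 200 * A'.card := by
    calc ξ / 8 * 2 ^ n = ξ / 2 * 2 ^ n / 4 := by ring
      _ ≤ _ := hA.trans hA'
      _ = _ := by field_simp
  have h2 : ξ ^ 257 ≤ ξ ^ 201 := pow_le_pow_of_le_one hξ.le hξ1 (by norm_num)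
  have h3 : ξ ^ 201 * 2 ^ n ≤ 16 * P ^ 20 * A'.card := by
    have := mul_le_mul_of_nonneg_right h1 (show (0 : ℝ) ≤ 8 * ξ ^ 200 by positivity)
    calc ξ ^ 201 * 2 ^ n = ξ / 8 * 2 ^ n * (8 * ξ ^ 200) := by ring
      _ ≤ _ := this
      _ = _ := by field_simp; ring
  calc 1 / (16 * P ^ 20) * ξ ^ 257 * 2 ^ n ≤ 1 / (16 * P ^ 20) * ξ ^ 201 * 2 ^ n := by gcongr
    _ = (ξ ^ 201 * 2 ^ n) / (16 * P ^ 20) := by ring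
    _ ≤ _ := by
      rw [div_le_iff₀ (by positivity)]
      linarith
end

section
/- Let A ⊆ (ℤ/2ℤ)^n be nonempty and suppose that φ : A → (ℤ/4ℤ)^n is a Freiman homomorphism of order 4. Then there exists s ∈ (ℤ/4ℤ)^n such that for all x ∈ A, every coordinate of φ(x) − s lies in {0, 2} ⊆ ℤ/4ℤ. -/
/-- If `A ⊆ (ℤ/2ℤ)^n` is nonempty and `φ` is a Freiman homomorphism of order `4` on `A`
into `(ℤ/4ℤ)^n`, then there is a shift `s ∈ (ℤ/4ℤ)^n` such that `φ(x) ∈ s + {0,2}^n` for all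
`x ∈ A`, i.e. every coordinate of `φ(x) − s` lies in `{0, 2} ⊆ ℤ/4ℤ`. -/
theorem freiman_hom_lands_in_shifted_two_torsion {n : ℕ}
    (A : Set (Fin n → ZMod 2)) (hA : A.Nonempty)
    (φ : (Fin n → ZMod 2) → (Fin n → ZMod 4)) (hφ : IsFreimanHomOn 4 A φ) :
    ∃ s : Fin n → ZMod 4, ∀ x ∈ A, ∀ i, φ x i - s i ∈ ({0, 2} : Set (ZMod 4)) := by
  obtain ⟨y, hy⟩ := hA
  refine ⟨φ y, fun x hx i => ?_⟩
  have h := hφ ![x, x, y, y] ![y, y, y, y]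
    (by intro j; fin_cases j <;> simpa) (by intro j; fin_cases j <;> simpa)
    (by
      have key : ∀ u v : ZMod 2, u + u + v + v = v + v + v + v := by decide
      funext j
      simpa [Fin.sum_univ_four] using key (x j) (y j))
  have h' := congrFun h i
  have key : ∀ u v : ZMod 4, u + u + v + v = v + v + v + v → u - v = 0 ∨ u - v = 2 := by
    decide
  exact key (φ x i) (φ y i) (by simpa [Fin.sum_univ_four] using h')
end

section
/- There is a constant c > 0 such that the following holds. Suppose F : (ℤ/2ℤ)^n → (ℤ/4ℤ)^n is a function for which there exist G, H : (ℤ/2ℤ)^n → (ℤ/4ℤ)^n such that the number of triples (x,y,z) ∈ ((ℤ/2ℤ)^n)^3 with x + y + z = 0 and F(x) + G(y) + H(z) = 0 is at least η · 4^n. Then there exists s ∈ (ℤ/4ℤ)^n such that |{x ∈ (ℤ/2ℤ)^n : F(x) ∈ s + {0,2}^n}| ≥ c · η^{1028} · 2^n. -/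
open Finset
open scoped Pointwise

open Classical in
lemma drc {V : Type*} [Fintype V] [Nonempty V] (R : V → V → Prop) (η : ℝ) (h0 : 0 < η)
    (h : η * (Fintype.card V : ℝ)^2 ≤ ∑ y : V, (#{x : V | R x y} : ℝ)) :
    ∃ A B : Finset V, η * Fintype.card V / 2 ≤ #A ∧ η * Fintype.card V / 4 ≤ #B ∧
      ∀ x ∈ B, ∀ x' ∈ B, (#A : ℝ) / 2 ≤ #{z ∈ A |
        η^2/16 * Fintype.card V ≤ (#{y : V | R x y ∧ R z y} : ℝ) ∧
        η^2/16 * Fintype.card V ≤ (#{y : V | R z y ∧ R x' y} : ℝ)} := by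
  set N : ℝ := (Fintype.card V : ℝ) with hN
  have hNpos : 0 < N := by simp [hN, Fintype.card_pos]
  set Nb : V → Finset V := fun y => {x : V | R x y} with hNb
  set cd : V → V → ℝ := fun x x' => (#{y : V | R x y ∧ R x' y} : ℝ) with hcd
  have hsymm : ∀ x x', cd x x' = cd x' x := by
    intro x x'; simp only [hcd, and_comm]
  set bad : V → Finset (V × V) := fun y => {p ∈ Nb y ×ˢ Nb y | cd p.1 p.2 < η^2/16*N} with hbad
  have h1 : η^2 * N^3 ≤ ∑ y, (#(Nb y) : ℝ)^2 := by
    have := sq_sum_le_card_mul_sum_sq (s := (Finset.univ : Finset V)) (f := fun y => (#(Nb y) : ℝ))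
    rw [Finset.card_univ, ← hN] at this
    have h2 : (η * N^2)^2 ≤ (∑ y, (#(Nb y) : ℝ))^2 := by gcongr
    have h3 : N * (η^2 * N^3) ≤ N * ∑ y, (#(Nb y) : ℝ)^2 := by nlinarith
    exact le_of_mul_le_mul_left h3 hNpos
  have h2 : ∑ y, (#(bad y) : ℝ) ≤ η^2/16 * N^3 := by
    have e : ∑ y, (#(bad y) : ℝ) = ∑ p : V × V with cd p.1 p.2 < η^2/16*N, cd p.1 p.2 := by
      have := Finset.sum_card_bipartiteAbove_eq_sum_card_bipartiteBelow
        (s := (univ : Finset V)) (t := ({p : V × V | cd p.1 p.2 < η^2/16*N} : Finset (V × V)))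
        (fun y p => R p.1 y ∧ R p.2 y)
      have t := congrArg (Nat.cast : ℕ → ℝ) this
      push_cast at t
      refine Eq.trans ?_ (t.trans ?_)
      · refine Finset.sum_congr rfl fun y _ => ?_
        congr 2
        ext p
        simp only [hbad, hNb, bipartiteAbove, mem_filter, mem_product, mem_univ, true_and]
        tauto
      · refine Finset.sum_congr rfl fun p _ => ?_
        simp [hcd, bipartiteBelow]
    rw [e]
    calc _ ≤ ∑ p : V × V with cd p.1 p.2 < η^2/16*N, η^2/16*N := by
          refine Finset.sum_le_sum fun p hp => ?_
          exact (mem_filter.1 hp).2.le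
      _ ≤ ∑ p : V × V, η^2/16*N := by
          refine Finset.sum_le_sum_of_subset_of_nonneg (filter_subset _ _) fun _ _ _ => by positivity
      _ = η^2/16 * N^3 := by
          simp [Fintype.card_prod, ← hN]; ring
  obtain ⟨y, -, hy⟩ : ∃ y ∈ (univ : Finset V), η^2*N^2/2 ≤ (#(Nb y) : ℝ)^2 - 8 * #(bad y) := by
    apply Finset.exists_le_of_sum_le univ_nonempty
    rw [Finset.sum_sub_distrib, ← Finset.mul_sum]
    simp [← hN]
    nlinarith
  set A := Nb y with hA
  set bd : V → Finset V := fun x => {z ∈ A | cd x z < η^2/16*N} with hbd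
  have hbs : (#(bad y) : ℝ) = ∑ x ∈ A, (#(bd x) : ℝ) := by
    have : #(bad y) = ∑ x ∈ A, #(bd x) := by
      simp only [hbad, hbd, card_filter, sum_product]
      rfl
    exact_mod_cast this
  have hA2 : η * N / 2 ≤ #A := by
    have hb : (0:ℝ) ≤ #(bad y) := by positivity
    refine abs_le_of_sq_le_sq' ?_ (by positivity) |>.2
    nlinarith [sq_nonneg (η * N)]
  have hApos : (0:ℝ) < #A := lt_of_lt_of_le (by positivity) hA2
  refine ⟨A, {x ∈ A | (#(bd x) : ℝ) ≤ #A / 4}, hA2, ?_, ?_⟩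
  · have hc : #{x ∈ A | (#(bd x) : ℝ) ≤ #A / 4} + #{x ∈ A | ¬ (#(bd x) : ℝ) ≤ #A / 4} = #A :=
      card_filter_add_card_filter_not _
    have hc' : (#{x ∈ A | (#(bd x) : ℝ) ≤ #A / 4} : ℝ) + #{x ∈ A | ¬ (#(bd x) : ℝ) ≤ #A / 4} = #A := by
      exact_mod_cast hc
    have : (#{x ∈ A | ¬ (#(bd x) : ℝ) ≤ #A / 4} : ℝ) * (#A / 4) ≤ #(bad y) := by
      rw [hbs, ← nsmul_eq_mul]
      refine le_trans (card_nsmul_le_sum _ (fun x => (#(bd x) : ℝ)) _ fun x hx => ?_)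
        (Finset.sum_le_sum_of_subset_of_nonneg (filter_subset _ _) fun _ _ _ => by positivity)
      exact (not_le.1 (mem_filter.1 hx).2).le
    have h8 : 8 * (#(bad y) : ℝ) ≤ (#A : ℝ)^2 := by nlinarith [sq_nonneg (η * N)]
    have : (#{x ∈ A | ¬ (#(bd x) : ℝ) ≤ #A / 4} : ℝ) ≤ #A / 2 := by
      by_contra hcon
      push Not at hcon this
      nlinarith
    linarith
  · intro x hx x' hx'
    have hx := (mem_filter.1 hx).2
    have hx' := (mem_filter.1 hx').2
    have hsub : A ⊆ {z ∈ A | η^2/16 * N ≤ cd x z ∧ η^2/16 * N ≤ cd z x'} ∪ (bd x ∪ bd x') := by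
      intro z hz
      simp only [hbd, mem_union, mem_filter, hz, true_and, hsymm z x']
      rcases lt_or_ge (cd x z) (η^2/16*N) with a | a
      · exact Or.inr (Or.inl a)
      rcases lt_or_ge (cd x' z) (η^2/16*N) with b | b
      · exact Or.inr (Or.inr b)
      · exact Or.inl ⟨a, b⟩
    have := (card_le_card hsub).trans ((card_union_le _ _).trans
      (Nat.add_le_add_left (card_union_le _ _) _))
    have : (#A : ℝ) ≤ #{z ∈ A | η^2/16 * N ≤ cd x z ∧ η^2/16 * N ≤ cd z x'} + (#(bd x) + #(bd x')) := by
      exact_mod_cast this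
    linarith

open Classical in
lemma diff_bound {V W : Type*} [Fintype V] [AddCommGroup V] [AddCommGroup W]
    (F G H : V → W) (A B : Finset V) (M δ : ℝ) (hδ : 0 ≤ δ)
    (h : ∀ x ∈ B, ∀ x' ∈ B, M ≤ #{z ∈ A |
        δ ≤ (#{y : V | F x + G y + H (x + y) = 0 ∧ F z + G y + H (z + y) = 0} : ℝ) ∧
        δ ≤ (#{y : V | F z + G y + H (z + y) = 0 ∧ F x' + G y + H (x' + y) = 0} : ℝ)}) :
    (#(B.image (fun x => (x, F x)) - B.image (fun x => (x, F x))) : ℝ) * (M * δ^2)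
      ≤ (Fintype.card V : ℝ)^4 := by
  set T := B.image (fun x => (x, F x))
  let Φ : V × V × V × V → V × W := fun p =>
    (p.1 - p.2.1 + p.2.2.1 - p.2.2.2, - H p.1 + H p.2.1 - H p.2.2.1 + H p.2.2.2)
  have key : ∀ d ∈ T - T, M * δ^2 ≤ (#{p : V × V × V × V | Φ p = d} : ℝ) := by
    intro d hd
    obtain ⟨a, ha, b, hb, rfl⟩ := Finset.mem_sub.1 hd
    obtain ⟨x, hx, rfl⟩ := mem_image.1 ha
    obtain ⟨x', hx', rfl⟩ := mem_image.1 hb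
    set Z := {z ∈ A |
        δ ≤ (#{y : V | F x + G y + H (x + y) = 0 ∧ F z + G y + H (z + y) = 0} : ℝ) ∧
        δ ≤ (#{y : V | F z + G y + H (z + y) = 0 ∧ F x' + G y + H (x' + y) = 0} : ℝ)} with hZ
    let S : Finset (Σ _ : V, V × V) := Z.sigma fun z =>
      ({y : V | F x + G y + H (x + y) = 0 ∧ F z + G y + H (z + y) = 0} : Finset V) ×ˢ
      ({y : V | F z + G y + H (z + y) = 0 ∧ F x' + G y + H (x' + y) = 0} : Finset V)
    have hS : M * δ^2 ≤ (#S : ℝ) := by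
      calc M * δ^2 ≤ #Z * δ^2 := by gcongr; exact h x hx x' hx'
        _ ≤ ∑ z ∈ Z, ((#{y : V | F x + G y + H (x + y) = 0 ∧ F z + G y + H (z + y) = 0} *
              #{y : V | F z + G y + H (z + y) = 0 ∧ F x' + G y + H (x' + y) = 0} : ℕ) : ℝ) := by
            rw [← nsmul_eq_mul]
            refine card_nsmul_le_sum _ _ _ fun z hz => ?_
            have := (mem_filter.1 hz).2
            push_cast
            rw [sq]
            exact mul_le_mul this.1 this.2 hδ (by positivity)
        _ = #S := by
            rw [card_sigma]; push_cast [card_product]; rfl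
    refine hS.trans ?_
    norm_cast
    refine card_le_card_of_injOn (fun s => (x + s.2.1, s.1 + s.2.1, s.1 + s.2.2, x' + s.2.2)) ?_ ?_
    · rintro ⟨z, y, y'⟩ hs
      simp only [S, coe_sigma, Set.mem_sigma_iff, mem_coe, mem_product, mem_filter, mem_univ, true_and] at hs
      obtain ⟨-, ⟨e1, e2⟩, e3, e4⟩ := hs
      simp only [coe_filter, mem_univ, true_and, Set.mem_ofPred_eq, Φ, Prod.mk_sub_mk, Prod.mk.injEq]
      refine ⟨by abel, ?_⟩
      rw [← sub_eq_zero]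
      have : (F z + G y + H (z + y)) - (F x + G y + H (x + y)) + (F x' + G y' + H (x' + y'))
        - (F z + G y' + H (z + y')) = 0 := by rw [e1, e2, e3, e4]; simp
      rw [← this]; abel
    · rintro ⟨z, y, y'⟩ - ⟨w, u, u'⟩ - hs
      simp only [Prod.mk.injEq, add_right_inj] at hs
      obtain ⟨rfl, h2, h3, rfl⟩ := hs
      simp at h2
      subst h2
      rfl
  have := card_nsmul_le_sum (T - T) (fun d => (#{p : V × V × V × V | Φ p = d} : ℝ)) _ key
  rw [nsmul_eq_mul] at this
  refine this.trans ?_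
  have h2 : ∑ d ∈ T - T, #{p : V × V × V × V | Φ p = d} ≤ #(univ : Finset (V × V × V × V)) := by
    rw [← card_biUnion]
    · exact card_le_card (subset_univ _)
    · intro a _ b _ hab
      rw [Function.onFun, disjoint_left]
      intro p hp hq
      exact hab ((mem_filter.1 hp).2.symm.trans (mem_filter.1 hq).2)
  have h3 : #(univ : Finset (V × V × V × V)) = Fintype.card V ^ 4 := by
    simp only [card_univ, Fintype.card_prod]; ring
  rw [h3] at h2
  exact_mod_cast h2

open Classical in
lemma fiber_bound {V W : Type*} [AddCommGroup V] [AddCommGroup W]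
    (hV : ∀ x : V, x + x = 0) (F : V → W) (B : Finset V) :
    #(B.image fun x => F x + F x) * #B ≤ #(3 • B.image (fun x => (x, F x))) := by
  rw [← card_product]
  refine card_le_card_of_injOn (fun p => (p.2, p.1 + F p.2)) ?_ ?_
  · rintro ⟨v, x⟩ hp
    simp only [coe_product, Set.mem_prod, mem_coe, mem_image] at hp
    obtain ⟨⟨y, hy, rfl⟩, hx⟩ := hp
    have : (x, F y + F y + F x) = ((y, F y) + (y, F y)) + (x, F x) := by simp [hV]
    rw [mem_coe]
    simp only
    rw [this, show 3 = 1 + 1 + 1 from rfl, add_nsmul, add_nsmul, one_nsmul]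
    have hT : ∀ y ∈ B, (y, F y) ∈ B.image (fun x => (x, F x)) := fun y hy => mem_image_of_mem _ hy
    exact add_mem_add (add_mem_add (hT _ hy) (hT _ hy)) (hT _ hx)
  · rintro ⟨v, x⟩ - ⟨w, y⟩ - hp
    simp only [Prod.mk.injEq] at hp
    obtain ⟨rfl, h⟩ := hp
    simpa using h


open Classical in
lemma main_abs {V W : Type*} [Fintype V] [AddCommGroup V] [AddCommGroup W]
    (hV : ∀ x : V, x + x = 0) (F G H : V → W) (η : ℝ) (h0 : 0 < η)
    (hGH : η * (Fintype.card V : ℝ) ^ 2 ≤ (Nat.card {p : V × V × V //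
      p.1 + p.2.1 + p.2.2 = 0 ∧ F p.1 + G p.2.1 + H p.2.2 = 0} : ℝ)) :
    ∃ x₀ : V, 1 / (4 * 4096 ^ 3) * η ^ 19 * (Fintype.card V : ℝ) ≤
      (Nat.card {x : V // F x + F x = F x₀ + F x₀} : ℝ) := by
  set N : ℝ := (Fintype.card V : ℝ) with hN
  have hNpos : 0 < N := by simp [hN, Fintype.card_pos]
  have hsum : η * (Fintype.card V : ℝ) ^ 2 ≤
      ∑ y : V, (#{x : V | F x + G y + H (-(x + y)) = 0} : ℝ) := by
    refine hGH.trans ?_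
    norm_cast
    rw [← card_sigma, Nat.card_eq_fintype_card, Fintype.card_subtype]
    refine card_le_card_of_injOn (fun p => ⟨p.2.1, p.1⟩) ?_ ?_
    · rintro ⟨x, y, z⟩ hp
      simp only [coe_filter, mem_univ, true_and, Set.mem_ofPred_eq] at hp
      simp only [coe_sigma, Set.mem_sigma_iff, mem_coe, mem_filter, mem_univ, true_and]
      rw [← eq_neg_of_add_eq_zero_right hp.1]
      exact hp.2
    · rintro ⟨x, y, z⟩ hp ⟨x', y', z'⟩ hp' he
      simp only [coe_filter, mem_univ, true_and, Set.mem_ofPred_eq] at hp hp'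
      simp only [Sigma.mk.injEq, heq_eq_eq] at he
      obtain ⟨rfl, rfl⟩ := he
      rw [eq_neg_of_add_eq_zero_right hp.1, eq_neg_of_add_eq_zero_right hp'.1]
  obtain ⟨A, B, hA, hB, hAB⟩ := drc (fun x y => F x + G y + H (-(x + y)) = 0) η h0 hsum
  have hd := diff_bound F G (fun x => H (-x)) A B _ (η ^ 2 / 16 * Fintype.card V)
    (by positivity) hAB
  have hf := fiber_bound (V := V) hV F B
  set T := B.image (fun x => (x, F x)) with hT
  have hTB : #T = #B := card_image_of_injective _ fun a b h => (Prod.mk.inj h).1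
  have hBpos : (0 : ℝ) < #B := lt_of_lt_of_le (by positivity) hB
  have hBne : B.Nonempty := card_pos.1 (by exact_mod_cast hBpos)
  have hp := pluennecke_ruzsa_inequality_nsmul_sub (A := T) (hBne.image _) T 3
  have hp' : (#(3 • T) : ℝ) ≤ ((#(T - T) : ℝ) / #T) ^ 3 * #T := by
    have := (NNRat.cast_le (K := ℝ)).2 hp
    push_cast at this
    exact this
  rw [hTB] at hp'
  set D := B.image fun x => F x + F x with hD
  have hf' : (#D : ℝ) * #B ≤ #(3 • T) := by exact_mod_cast hf
  have hDK : (#D : ℝ) ≤ ((#(T - T) : ℝ) / #B) ^ 3 :=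
    le_of_mul_le_mul_right (hf'.trans hp') hBpos
  have hK1 : (#(T - T) : ℝ) * η ^ 5 ≤ 1024 * N := by
    have e : (#(T - T) : ℝ) * ((η * N / 2) / 2 * (η ^ 2 / 16 * N) ^ 2) ≤ N ^ 4 := by
      refine le_trans ?_ hd
      gcongr
    have : N ^ 3 * ((#(T - T) : ℝ) * η ^ 5) ≤ N ^ 3 * (1024 * N) := by linarith
    exact le_of_mul_le_mul_left this (by positivity)
  have hK : (#(T - T) : ℝ) / #B * η ^ 6 ≤ 4096 := by
    rw [div_mul_eq_mul_div, div_le_iff₀ hBpos]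
    have := mul_le_mul_of_nonneg_right hK1 h0.le
    nlinarith
  have hDη : (#D : ℝ) * η ^ 18 ≤ 4096 ^ 3 := by
    calc (#D : ℝ) * η ^ 18 ≤ ((#(T - T) : ℝ) / #B) ^ 3 * η ^ 18 := by gcongr
      _ = ((#(T - T) : ℝ) / #B * η ^ 6) ^ 3 := by ring
      _ ≤ 4096 ^ 3 := by gcongr
  obtain ⟨v, hv, hvc⟩ := exists_le_card_fiber_of_nsmul_le_card_of_maps_to
    (s := B) (t := D) (f := fun x => F x + F x) (b := 1 / (4 * 4096 ^ 3) * η ^ 19 * N)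
    (fun a ha => mem_image_of_mem _ ha) (hBne.image _) (by
      rw [nsmul_eq_mul]
      refine le_trans ?_ hB
      have := mul_le_mul_of_nonneg_right hDη (show 0 ≤ η * N / (4 * 4096 ^ 3) by positivity)
      calc _ = (#D : ℝ) * η ^ 18 * (η * N / (4 * 4096 ^ 3)) := by ring
        _ ≤ _ := this
        _ = _ := by ring)
  obtain ⟨x₀, -, rfl⟩ := mem_image.1 hv
  refine ⟨x₀, hvc.trans ?_⟩
  norm_cast
  rw [Nat.card_eq_fintype_card, Fintype.card_subtype]
  exact card_le_card (filter_subset_filter _ (subset_univ _))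

/-- There is `c > 0` such that: if `F : (ℤ/2ℤ)^n → (ℤ/4ℤ)^n` admits `G, H` with
`F(x) + G(y) + H(z) = 0` on at least `η · 4^n` of the triples with `x + y + z = 0`, then there
is a shift `s ∈ (ℤ/4ℤ)^n` with `F(x) ∈ s + {0,2}^n` for at least `c · η^1028 · 2^n` points `x`. -/
theorem structure_from_test :
    ∃ c : ℝ, 0 < c ∧
      ∀ (n : ℕ) (F : (Fin n → ZMod 2) → (Fin n → ZMod 4)) (η : ℝ), 0 < η → η ≤ 1 →
        (∃ G H : (Fin n → ZMod 2) → (Fin n → ZMod 4),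
          η * 4 ^ n ≤
            (Nat.card {p : (Fin n → ZMod 2) × (Fin n → ZMod 2) × (Fin n → ZMod 2) //
              p.1 + p.2.1 + p.2.2 = 0 ∧ F p.1 + G p.2.1 + H p.2.2 = 0} : ℝ)) →
        ∃ s : Fin n → ZMod 4,
          c * η ^ 1028 * 2 ^ n ≤
            (Nat.card {x : Fin n → ZMod 2 //
              ∀ i, F x i - s i ∈ ({0, 2} : Set (ZMod 4))} : ℝ) := by
  refine ⟨1 / (4 * 4096 ^ 3), by positivity, ?_⟩
  rintro n F η h0 h1 ⟨G, H, hGH⟩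
  have hcard : (Fintype.card (Fin n → ZMod 2) : ℝ) = 2 ^ n := by simp [ZMod.card]
  have h4 : ((2 : ℝ) ^ n) ^ 2 = 4 ^ n := by
    rw [← pow_mul, mul_comm, pow_mul]; norm_num
  obtain ⟨x₀, hx₀⟩ := main_abs (V := Fin n → ZMod 2)
    (fun x => by funext i; exact CharTwo.add_self_eq_zero (x i)) F G H η h0
    (by rw [hcard, h4]; exact hGH)
  rw [hcard] at hx₀
  refine ⟨F x₀, ?_⟩
  have hpow : η ^ 1028 ≤ η ^ 19 := pow_le_pow_of_le_one h0.le h1 (by norm_num)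
  refine le_trans (by gcongr) (hx₀.trans ?_)
  norm_cast
  have hdec : ∀ a b : ZMod 4, a + a = b + b → a - b = 0 ∨ a - b = 2 := by decide
  refine Nat.card_le_card_of_injective (fun x => ⟨x.1, fun i => ?_⟩) ?_
  · simpa using hdec _ _ (congrFun x.2 i)
  · intro x y h
    exact Subtype.ext (Subtype.mk.inj h)
end
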